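/- arXiv:2501.06352 — 3 statements merged into one kernel-verified Lean document; each statement's English description precedes it below -/
import Mathlib

section
/- Let n, k be nonnegative integers with n ≥ 1 and k ≤ 2, and let M be a compact orientable surface with boundary homeomorphic to a sphere with n + k open disks removed, where n boundary circles are marked Dirichlet-type and k are marked Neumann-type. Then M can be decomposed (by cutting along disjoint simple closed curves in the interior, each cut circle marked Neumann-type on both sides) into finitely many pieces, each of which is homeomorphic to one of: a disk with its boundary Dirichlet-type, a cylinder with one Dirichlet-type and one Neumann-type boundary, or a pair of pants with one Dirichlet-type and two Neumann-type boundaries, with all interior cuts matching Neumann-type boundaries to Neumann-type boundaries. -/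
open Metric

/-- A planar model of the sphere with `m` holes (`m ≥ 1`): the closed disk of
radius `m` with `m - 1` small round open disks removed. -/
def SphereWithHoles (m : ℕ) : Set ℂ :=
  {z : ℂ | ‖z‖ ≤ (m : ℝ) ∧ ∀ j : ℕ, j < m - 1 → (1/4 : ℝ) ≤ ‖z - ((j : ℂ) + 1)‖}

/-- The `m` boundary circles of the model sphere with `m` holes: the outer
circle and the `m - 1` inner circles. -/
def BCircle (m : ℕ) (j : Fin m) : Set ℂ :=
  if j.val = 0 then Metric.sphere (0 : ℂ) (m : ℝ)
  else Metric.sphere ((j.val : ℂ)) (1/4 : ℝ)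

/-- The three model pieces: a disk, a cylinder (annulus) and a pair of pants. -/
def PieceSet : Fin 3 → Set ℂ :=
  ![Metric.closedBall (0 : ℂ) 1,
    {z : ℂ | 1 ≤ ‖z‖ ∧ ‖z‖ ≤ 2},
    {z : ℂ | ‖z‖ ≤ 4 ∧ 1 ≤ ‖z - 2‖ ∧ 1 ≤ ‖z + 2‖}]

/-- The Dirichlet-type boundary of each model piece. -/
def PieceDir : Fin 3 → Set ℂ :=
  ![Metric.sphere (0 : ℂ) 1, Metric.sphere (0 : ℂ) 1, Metric.sphere (0 : ℂ) 4]

/-- The Neumann-type boundary of each model piece. -/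
def PieceNeu : Fin 3 → Set ℂ :=
  ![∅, Metric.sphere (0 : ℂ) 2, Metric.sphere (2 : ℂ) 1 ∪ Metric.sphere (-2 : ℂ) 1]

def TE (p d v q d' v' : Set ℂ) : Prop :=
  ∃ f : ℂ → ℂ, ContinuousOn f p ∧ Set.InjOn f p ∧ f '' p = q ∧
    ∀ z ∈ p, (z ∈ d ↔ f z ∈ d') ∧ (z ∈ v ↔ f z ∈ v')

theorem TE.congr {p d v p' d' v' : Set ℂ} (hp : p = p')
    (h : ∀ z ∈ p, (z ∈ d ↔ z ∈ d') ∧ (z ∈ v ↔ z ∈ v')) : TE p d v p' d' v' :=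
  ⟨id, continuousOn_id, Set.injOn_id _, by simp [hp], h⟩

theorem TE.trans {p d v p' d' v' p'' d'' v'' : Set ℂ} (h1 : TE p d v p' d' v')
    (h2 : TE p' d' v' p'' d'' v'') : TE p d v p'' d'' v'' := by
  obtain ⟨f, fc, fi, fe, fd⟩ := h1
  obtain ⟨g, gc, gi, ge, gd⟩ := h2
  have hm : Set.MapsTo f p p' := by
    intro z hz; rw [← fe]; exact ⟨z, hz, rfl⟩
  refine ⟨g ∘ f, gc.comp fc hm, gi.comp fi hm, ?_, ?_⟩
  · rw [Set.image_comp, fe, ge]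
  · intro z hz
    exact ⟨(fd z hz).1.trans (gd _ (hm hz)).1, (fd z hz).2.trans (gd _ (hm hz)).2⟩

theorem exists_homeo {p q : Set ℂ} (hp : IsCompact p) {f : ℂ → ℂ} (fc : ContinuousOn f p)
    (fi : Set.InjOn f p) (fe : f '' p = q) : ∃ h : p ≃ₜ q, ∀ x : p, (h x : ℂ) = f x := by
  have : CompactSpace p := isCompact_iff_compactSpace.mp hp
  have hb : Set.BijOn f p q := ⟨fun z hz => fe ▸ ⟨z, hz, rfl⟩, fi, by rw [Set.SurjOn, fe]⟩
  let E : p ≃ q := hb.equiv f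
  have hE : Continuous E := by
    refine Continuous.subtype_mk ?_ _
    exact continuousOn_iff_continuous_domRestrict.mp fc
  exact ⟨hE.homeoOfEquivCompactToT2, fun x => rfl⟩

theorem TE.symm {p d v q d' v' : Set ℂ} (hp : IsCompact p) (h1 : TE p d v q d' v') :
    TE q d' v' p d v := by
  obtain ⟨f, fc, fi, fe, fd⟩ := h1
  obtain ⟨h, hh⟩ := exists_homeo hp fc fi fe
  classical
  let g : ℂ → ℂ := fun w => if hw : w ∈ q then (h.symm ⟨w, hw⟩ : ℂ) else 0
  have hg : ∀ w (hw : w ∈ q), g w = h.symm ⟨w, hw⟩ := fun w hw => by simp [g, hw]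
  have hfg : ∀ w (hw : w ∈ q), f (g w) = w := by
    intro w hw
    rw [hg w hw, ← hh]; simp
  have hgp : ∀ w (hw : w ∈ q), g w ∈ p := by
    intro w hw
    rw [hg w hw]; exact Subtype.coe_prop _
  refine ⟨g, ?_, ?_, ?_, ?_⟩
  · rw [continuousOn_iff_continuous_domRestrict]
    have : q.domRestrict g = fun w => (h.symm w : ℂ) := by
      ext w; simp [Set.domRestrict, hg w.1 w.2]
    rw [this]
    fun_prop
  · intro x hx y hy hxy
    rw [← hfg x hx, ← hfg y hy, hxy]
  · apply Set.eq_of_subset_of_subset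
    · rintro _ ⟨w, hw, rfl⟩; exact hgp w hw
    · intro z hz
      have hq : f z ∈ q := fe ▸ ⟨z, hz, rfl⟩
      exact ⟨f z, hq, fi (hgp _ hq) hz (hfg _ hq)⟩
  · intro w hw
    have := fd (g w) (hgp w hw)
    rw [hfg w hw] at this
    exact ⟨this.1.symm, this.2.symm⟩

theorem TE.of_bij {p d v q d' v' : Set ℂ} (f : ℂ → ℂ) (hc : Continuous f)
    (hb : Function.Bijective f) (h : ∀ z, (z ∈ p ↔ f z ∈ q) ∧ (z ∈ d ↔ f z ∈ d') ∧
      (z ∈ v ↔ f z ∈ v')) : TE p d v q d' v' := by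
  refine ⟨f, hc.continuousOn, hb.1.injOn, ?_, fun z _ => (h z).2⟩
  apply Set.eq_of_subset_of_subset
  · rintro _ ⟨w, hw, rfl⟩; exact (h w).1.1 hw
  · intro w hw
    obtain ⟨z, rfl⟩ := hb.2 w
    exact ⟨z, (h z).1.2 hw, rfl⟩

/-- cutoff function -/
noncomputable def cut (r ρ s : ℝ) : ℝ := max 0 (min 1 ((ρ - s) / (ρ - r)))

theorem cut_cont (r ρ : ℝ) : Continuous (cut r ρ) := by
  unfold cut; fun_prop

theorem cut_nonneg (r ρ s : ℝ) : 0 ≤ cut r ρ s := le_max_left _ _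

theorem cut_le_one (r ρ s : ℝ) : cut r ρ s ≤ 1 := by
  unfold cut; exact max_le zero_le_one (min_le_left _ _)

theorem cut_in {r ρ s : ℝ} (h : r < ρ) (hs : s ≤ r) : cut r ρ s = 1 := by
  unfold cut
  have : 1 ≤ (ρ - s) / (ρ - r) := by rw [le_div_iff₀ (by linarith)]; linarith
  rw [min_eq_left this]; simp

theorem cut_out {r ρ s : ℝ} (h : r < ρ) (hs : ρ ≤ s) : cut r ρ s = 0 := by
  unfold cut
  have : (ρ - s) / (ρ - r) ≤ 0 := div_nonpos_of_nonpos_of_nonneg (by linarith) (by linarith)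
  exact max_eq_left ((min_le_right _ _).trans this)

theorem cut_anti {r ρ s t : ℝ} (h : r < ρ) (hs : s ≤ t) : cut r ρ t ≤ cut r ρ s := by
  unfold cut
  have : (0:ℝ) < ρ - r := by linarith
  gcongr

theorem cut_lip {r ρ : ℝ} (s t : ℝ) (h : r < ρ) :
    |cut r ρ s - cut r ρ t| ≤ |s - t| / (ρ - r) := by
  unfold cut
  have h0 : (0:ℝ) < ρ - r := by linarith
  calc _ ≤ |min 1 ((ρ - s) / (ρ - r)) - min 1 ((ρ - t) / (ρ - r))| := by
        simpa using abs_max_sub_max_le_abs (min 1 ((ρ - s) / (ρ - r))) (min 1 ((ρ - t) / (ρ - r))) 0 |> fun h => by simpa [max_comm] using h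
    _ ≤ |(ρ - s) / (ρ - r) - (ρ - t) / (ρ - r)| := by
        have := abs_min_sub_min_le_max 1 ((ρ - s) / (ρ - r)) 1 ((ρ - t) / (ρ - r))
        simpa using this
    _ = |s - t| / (ρ - r) := by
        rw [← sub_div, abs_div, abs_of_pos h0, abs_sub_comm]; congr 2; ring

/-- the push map -/
noncomputable def push (c v : ℂ) (r ρ : ℝ) (z : ℂ) : ℂ := z + (cut r ρ ‖z - c‖ : ℂ) * v

theorem push_cont (c v : ℂ) (r ρ : ℝ) : Continuous (push c v r ρ) := by
  unfold push
  have := cut_cont r ρ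
  fun_prop

theorem push_bij (c v : ℂ) (r ρ : ℝ) (h : ‖v‖ < ρ - r) : Function.Bijective (push c v r ρ) := by
  have h0 : (0:ℝ) < ρ - r := (norm_nonneg v).trans_lt h
  let K : NNReal := ⟨‖v‖ / (ρ - r), by positivity⟩
  have hK : K < 1 := by
    rw [← NNReal.coe_lt_coe]; show ‖v‖ / (ρ - r) < 1
    rw [div_lt_one h0]; exact h
  have key : ∀ x y : ℂ, ‖(cut r ρ ‖x - c‖ : ℂ) * v - (cut r ρ ‖y - c‖ : ℂ) * v‖ ≤ K * ‖x - y‖ := by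
    intro x y
    rw [← sub_mul, norm_mul, ← Complex.ofReal_sub, Complex.norm_real, Real.norm_eq_abs]
    have h1 := cut_lip ‖x - c‖ ‖y - c‖ (show r < ρ by linarith)
    have h2 : |‖x - c‖ - ‖y - c‖| ≤ ‖x - y‖ := by
      have := abs_norm_sub_norm_le (x - c) (y - c); simpa using this
    show _ ≤ ‖v‖ / (ρ - r) * ‖x - y‖
    calc _ ≤ (‖x - y‖ / (ρ - r)) * ‖v‖ := by
          apply mul_le_mul_of_nonneg_right _ (norm_nonneg _)
          refine h1.trans ?_
          gcongr
      _ = _ := by ring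
  have hA : ApproximatesLinearOn (push c v r ρ)
      ((ContinuousLinearEquiv.refl ℝ ℂ : ℂ ≃L[ℝ] ℂ) : ℂ →L[ℝ] ℂ) Set.univ K := by
    intro x _ y _
    have e : push c v r ρ x - push c v r ρ y -
        ((ContinuousLinearEquiv.refl ℝ ℂ : ℂ ≃L[ℝ] ℂ) : ℂ →L[ℝ] ℂ) (x - y) =
        (cut r ρ ‖x - c‖ : ℂ) * v - (cut r ρ ‖y - c‖ : ℂ) * v := by
      simp [push]; ring
    rw [e]; exact key x y
  have hc : Subsingleton ℂ ∨
      K < ‖((ContinuousLinearEquiv.refl ℝ ℂ).symm : ℂ →L[ℝ] ℂ)‖₊⁻¹ := by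
    right
    have : ‖((ContinuousLinearEquiv.refl ℝ ℂ).symm : ℂ →L[ℝ] ℂ)‖₊ = 1 := by
      simp
    rw [this]; simpa using hK
  exact ⟨Set.injOn_univ.mp (hA.injOn hc), hA.surjective hc⟩

/-- the shrinking map -/
noncomputable def shrink (c : ℂ) (l r ρ : ℝ) (z : ℂ) : ℂ :=
  c + (z - c) * ((1 - l * cut r ρ ‖z - c‖ : ℝ) : ℂ)

theorem shrink_cont (c : ℂ) (l r ρ : ℝ) : Continuous (shrink c l r ρ) := by
  unfold shrink
  have := cut_cont r ρ
  fun_prop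

theorem shrink_aux {l r ρ s t : ℝ} (hr : r < ρ) (h0 : 0 ≤ l) (h1 : l < 1) (hs : 0 ≤ s) (hst : s < t) :
    s * (1 - l * cut r ρ s) < t * (1 - l * cut r ρ t) := by
  have h2 := cut_anti hr hst.le
  have h3 := cut_le_one r ρ t
  have h4 := cut_nonneg r ρ t
  have h5 : 0 < 1 - l * cut r ρ t := by nlinarith
  calc _ ≤ s * (1 - l * cut r ρ t) := by gcongr
    _ < _ := by gcongr

theorem shrink_norm (c : ℂ) {l r ρ : ℝ} (h0 : 0 ≤ l) (h1 : l < 1) (z : ℂ) :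
    ‖shrink c l r ρ z - c‖ = ‖z - c‖ * (1 - l * cut r ρ ‖z - c‖) := by
  have h3 := cut_le_one r ρ ‖z - c‖
  have h4 := cut_nonneg r ρ ‖z - c‖
  have h5 : 0 < 1 - l * cut r ρ ‖z - c‖ := by nlinarith
  unfold shrink
  rw [add_sub_cancel_left, norm_mul, Complex.norm_real, Real.norm_of_nonneg h5.le]

theorem shrink_bij (c : ℂ) {l r ρ : ℝ} (hr : r < ρ) (h0 : 0 ≤ l) (h1 : l < 1) :
    Function.Bijective (shrink c l r ρ) := by
  have hpos : ∀ s, 0 < 1 - l * cut r ρ s := fun s => by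
    have h3 := cut_le_one r ρ s
    have h4 := cut_nonneg r ρ s
    nlinarith
  constructor
  · intro x y hxy
    have hn : ‖x - c‖ = ‖y - c‖ := by
      have e : ‖shrink c l r ρ x - c‖ = ‖shrink c l r ρ y - c‖ := by rw [hxy]
      rw [shrink_norm c h0 h1, shrink_norm c h0 h1] at e
      rcases lt_trichotomy ‖x - c‖ ‖y - c‖ with h | h | h
      · exact absurd e (shrink_aux hr h0 h1 (norm_nonneg _) h).ne
      · exact h
      · exact absurd e (shrink_aux hr h0 h1 (norm_nonneg _) h).ne'
    unfold shrink at hxy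
    rw [hn] at hxy
    have := mul_right_cancel₀ (by exact_mod_cast (hpos _).ne') (add_left_cancel hxy)
    exact sub_left_injective this
  · intro w
    set u := ‖w - c‖
    have hcont : ContinuousOn (fun s => s * (1 - l * cut r ρ s)) (Set.Icc 0 (u / (1 - l))) := by
      have := cut_cont r ρ
      fun_prop
    have hu : 0 ≤ u := norm_nonneg _
    have hl : 0 < 1 - l := by linarith
    have hmem := intermediate_value_Icc (by positivity) hcont
    obtain ⟨s, hs, hsu⟩ := hmem (show u ∈ _ by
      constructor
      · simpa using hu
      · show u ≤ u / (1 - l) * (1 - l * cut r ρ (u / (1 - l)))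
        have h3 := cut_le_one r ρ (u / (1 - l))
        calc u = u / (1 - l) * (1 - l) := by field_simp
          _ ≤ _ := by
            apply mul_le_mul_of_nonneg_left _ (by positivity)
            nlinarith)
    have hsu : s * (1 - l * cut r ρ s) = u := hsu
    refine ⟨c + (w - c) / ((1 - l * cut r ρ s : ℝ) : ℂ), ?_⟩
    have hne : ((1 - l * cut r ρ s : ℝ) : ℂ) ≠ 0 := by exact_mod_cast (hpos s).ne'
    have hnorm : ‖(w - c) / ((1 - l * cut r ρ s : ℝ) : ℂ)‖ = s := by
      rw [norm_div, Complex.norm_real, Real.norm_of_nonneg (hpos s).le, div_eq_iff (hpos s).ne']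
      exact hsu.symm
    unfold shrink
    rw [add_sub_cancel_left, hnorm, div_mul_cancel₀ _ hne]; ring

def PP (R a r b s : ℝ) : Set ℂ := {z | ‖z‖ ≤ R ∧ r ≤ ‖z - (a : ℂ)‖ ∧ s ≤ ‖z - (b : ℂ)‖}
def PV (a r b s : ℝ) : Set ℂ := {z | ‖z - (a : ℂ)‖ = r ∨ ‖z - (b : ℂ)‖ = s}
def NS (R : ℝ) : Set ℂ := {z | ‖z‖ = R}
def PE (R a r b s R' a' r' b' s' : ℝ) : Prop :=
  TE (PP R a r b s) (NS R) (PV a r b s) (PP R' a' r' b' s') (NS R') (PV a' r' b' s')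
def VV (R a r b s : ℝ) : Prop := 0 < r ∧ 0 < s ∧ -R < a - r ∧ a + r < b - s ∧ b + s < R

theorem PP_compact (R a r b s : ℝ) : IsCompact (PP R a r b s) := by
  apply (isCompact_closedBall (0:ℂ) R).of_isClosed_subset
  · have h1 : IsClosed {z : ℂ | ‖z‖ ≤ R} := isClosed_le (by fun_prop) (by fun_prop)
    have h2 : IsClosed {z : ℂ | r ≤ ‖z - (a:ℂ)‖} := isClosed_le (by fun_prop) (by fun_prop)
    have h3 : IsClosed {z : ℂ | s ≤ ‖z - (b:ℂ)‖} := isClosed_le (by fun_prop) (by fun_prop)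
    exact h1.inter (h2.inter h3)
  · rintro z ⟨h, -⟩; simpa using h

theorem PE.trans {R a r b s R' a' r' b' s' R'' a'' r'' b'' s'' : ℝ}
    (h : PE R a r b s R' a' r' b' s') (h' : PE R' a' r' b' s' R'' a'' r'' b'' s'') :
    PE R a r b s R'' a'' r'' b'' s'' := TE.trans h h'

theorem PE.symm {R a r b s R' a' r' b' s' : ℝ}
    (h : PE R a r b s R' a' r' b' s') : PE R' a' r' b' s' R a r b s :=
  TE.symm (PP_compact _ _ _ _ _) h

theorem PE.local {R a r b s a' r' c ρ : ℝ} (f : ℂ → ℂ) (hc : Continuous f)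
    (hb : Function.Bijective f) (hid : ∀ z, ρ ≤ ‖z - (c:ℂ)‖ → f z = z)
    (h1 : |c| + ρ ≤ R) (h2 : c + ρ + s ≤ b)
    (hr : ∀ z, (r ≤ ‖z - (a:ℂ)‖ ↔ r' ≤ ‖f z - (a':ℂ)‖) ∧ (‖z - (a:ℂ)‖ = r ↔ ‖f z - (a':ℂ)‖ = r')) :
    PE R a r b s R a' r' b s := by
  have hball : ∀ z : ℂ, ‖z - (c:ℂ)‖ < ρ → ‖z‖ < R ∧ s < ‖z - (b:ℂ)‖ := by
    intro z hz
    constructor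
    · have : ‖z‖ ≤ ‖z - (c:ℂ)‖ + ‖(c:ℂ)‖ := by simpa using norm_add_le (z - (c:ℂ)) c
      rw [Complex.norm_real, Real.norm_eq_abs] at this
      linarith
    · have : ‖((b - c : ℝ) : ℂ)‖ ≤ ‖z - (c:ℂ)‖ + ‖z - (b:ℂ)‖ := by
        have := norm_sub_le (z - (c:ℂ)) (z - b)
        push_cast
        simpa using this
      rw [Complex.norm_real, Real.norm_eq_abs] at this
      have := le_abs_self (b - c)
      linarith
  refine TE.of_bij f hc hb fun z => ?_
  by_cases hz : ρ ≤ ‖z - (c:ℂ)‖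
  · have h := hid z hz
    have h' := hr z
    simp only [PP, PV, NS, Set.mem_ofPred_eq]
    rw [h'.1, h'.2]
    rw [h]
    simp
  · have hz' : ¬ ρ ≤ ‖f z - (c:ℂ)‖ := by
      intro h
      have := hb.1 (hid _ h)
      rw [this] at h; exact hz h
    obtain ⟨e1, e2⟩ := hball z (not_le.mp hz)
    obtain ⟨e3, e4⟩ := hball (f z) (not_le.mp hz')
    have h' := hr z
    simp only [PP, PV, NS, Set.mem_ofPred_eq]
    rw [h'.1, h'.2]
    simp [e1.le, e2.le, e3.le, e4.le, e1.ne, e2.ne', e3.ne, e4.ne']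

theorem push_hole (c v : ℂ) {r ρ : ℝ} (h : ‖v‖ < ρ - r) (z : ℂ) :
    (r ≤ ‖z - c‖ ↔ r ≤ ‖push c v r ρ z - (c + v)‖) ∧
    (‖z - c‖ = r ↔ ‖push c v r ρ z - (c + v)‖ = r) := by
  have hr : r < ρ := by linarith [norm_nonneg v]
  have hin : ∀ z : ℂ, ‖z - c‖ ≤ r → push c v r ρ z = z + v := by
    intro z hz
    simp [push, cut_in hr hz]
  by_cases hz : ‖z - c‖ ≤ r
  · rw [hin z hz]
    simp
  · have : ¬ ‖push c v r ρ z - (c + v)‖ ≤ r := by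
      intro h'
      set w := push c v r ρ z with hw
      have e : ‖(w - v) - c‖ ≤ r := by convert h' using 2; ring
      have e2 := hin _ e
      rw [sub_add_cancel, hw] at e2
      have := (push_bij c v r ρ h).1 e2
      rw [← hw] at this
      rw [this] at e
      exact hz e
    push Not at this hz
    simp [this.le, hz.le, this.ne', hz.ne']

theorem push_out (c v : ℂ) {r ρ : ℝ} (h : r < ρ) (z : ℂ) (hz : ρ ≤ ‖z - c‖) :
    push c v r ρ z = z := by
  simp [push, cut_out h hz]

theorem shrink_out (c : ℂ) {l r ρ : ℝ} (h : r < ρ) (z : ℂ) (hz : ρ ≤ ‖z - c‖) :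
    shrink c l r ρ z = z := by
  simp [shrink, cut_out h hz]

theorem PE.shrinkL {R a r b s r' : ℝ} (h : VV R a r b s) (h0 : 0 < r') (h1 : r' ≤ r) :
    PE R a r b s R a r' b s := by
  obtain ⟨v1, v2, v3, v4, v5⟩ := h
  set ρ := min (R + a) (b - s - a) with hρ
  have hr : r < ρ := by rw [hρ, lt_min_iff]; constructor <;> linarith
  have e1 : ρ ≤ R + a := min_le_left _ _
  have e2 : ρ ≤ b - s - a := min_le_right _ _
  set l := 1 - r' / r with hl
  have l0 : 0 ≤ l := by rw [hl, sub_nonneg, div_le_one v1]; exact h1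
  have l1 : l < 1 := by rw [hl]; have : 0 < r' / r := by positivity
                        linarith
  refine PE.local (c := a) (ρ := ρ) (shrink a l r ρ) (shrink_cont _ _ _ _) (shrink_bij _ hr l0 l1)
    (shrink_out _ hr) ?_ ?_ ?_
  · rcases abs_cases a with ⟨h, _⟩ | ⟨h, _⟩ <;> rw [h] <;> linarith
  · linarith
  · intro z
    rw [shrink_norm _ l0 l1]
    have hg : r * (1 - l * cut r ρ r) = r' := by
      rw [cut_in hr le_rfl, hl]; field_simp; ring
    generalize hs : ‖z - (a:ℂ)‖ = t
    have t0 : 0 ≤ t := hs ▸ norm_nonneg _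
    rcases lt_trichotomy t r with h | h | h
    · have := shrink_aux hr l0 l1 t0 h
      rw [hg] at this
      simp [h.ne, this.ne, h.not_ge, this.not_ge]
    · rw [h, hg]; simp
    · have := shrink_aux hr l0 l1 v1.le h
      rw [hg] at this
      simp [h.ne', this.ne', h.le, this.le]

theorem PE.pushC {R c r b s ρ a : ℝ} (hv : |a - c| < ρ - r) (h1 : |c| + ρ ≤ R)
    (h2 : c + ρ + s ≤ b) : PE R c r b s R a r b s := by
  have hv' : ‖((a - c : ℝ) : ℂ)‖ < ρ - r := by rwa [Complex.norm_real, Real.norm_eq_abs]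
  have hr : r < ρ := by linarith [abs_nonneg (a - c)]
  refine PE.local (c := c) (ρ := ρ) (push c ((a - c : ℝ) : ℂ) r ρ) (push_cont _ _ _ _)
    (push_bij _ _ _ _ hv') (push_out _ _ hr) h1 h2 ?_
  intro z
  have := push_hole (c:ℂ) _ hv' z
  convert this using 4 <;> push_cast <;> ring

theorem PE.pushL {R a r b s a' : ℝ} (hr : 0 < r) (hb : b - s ≤ R) (h1 : -R < a - 2 * r) (h2 : -R < a' - 2 * r)
    (h3 : a + 2 * r < b - s) (h4 : a' + 2 * r < b - s) : PE R a r b s R a' r b s := by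
  have key : ∀ x : ℝ, x = a ∨ x = a' → PE R ((a + a') / 2) r b s R x r b s := by
    intro x hx
    apply PE.pushC (ρ := |a - a'| / 2 + 2 * r)
    · have : |x - (a + a') / 2| = |a - a'| / 2 := by
        rcases hx with rfl | rfl
        · rw [show x - (x + a') / 2 = (x - a') / 2 by ring, abs_div]; simp
        · rw [show x - (a + x) / 2 = -((a - x) / 2) by ring, abs_neg, abs_div]; simp
      rw [this]; linarith
    · rcases abs_cases (a - a') with ⟨h, _⟩ | ⟨h, _⟩ <;>
      rcases abs_cases ((a + a') / 2) with ⟨h', _⟩ | ⟨h', _⟩ <;> rw [h, h'] <;> linarith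
    · rcases abs_cases (a - a') with ⟨h, _⟩ | ⟨h, _⟩ <;> rw [h] <;> linarith
  exact (key a (Or.inl rfl)).symm.trans (key a' (Or.inr rfl))

theorem PE.mirror (R a r b s : ℝ) : PE R a r b s R (-b) s (-a) r := by
  refine TE.of_bij (fun z => -z) (by fun_prop) (Equiv.neg ℂ).bijective fun z => ?_
  have e : ∀ x : ℝ, ‖-z - ((-x : ℝ) : ℂ)‖ = ‖z - (x:ℂ)‖ := by
    intro x; rw [← norm_neg]; congr 1; push_cast; ring
  simp only [PP, PV, NS, Set.mem_ofPred_eq, e, norm_neg]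
  tauto

theorem PE.scale (R a r b s k : ℝ) (hk : 0 < k) :
    PE R a r b s (k * R) (k * a) (k * r) (k * b) (k * s) := by
  have hk' : (k:ℂ) ≠ 0 := by exact_mod_cast hk.ne'
  refine TE.of_bij (fun z => k * z) (by fun_prop) (Equiv.mulLeft₀ (k:ℂ) hk').bijective fun z => ?_
  have e : ∀ x : ℝ, ‖k * z - ((k * x : ℝ) : ℂ)‖ = k * ‖z - (x:ℂ)‖ := by
    intro x; push_cast; rw [← mul_sub, norm_mul, Complex.norm_real, Real.norm_of_nonneg hk.le]
  have e' : ‖(k:ℂ) * z‖ = k * ‖z‖ := by simpa using e 0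
  simp only [PP, PV, NS, Set.mem_ofPred_eq, e, e', mul_le_mul_iff_right₀ hk, mul_right_inj' hk.ne']
  tauto

theorem VV.mirror {R a r b s : ℝ} (h : VV R a r b s) : VV R (-b) s (-a) r := by
  obtain ⟨v1, v2, v3, v4, v5⟩ := h
  refine ⟨v2, v1, ?_, ?_, ?_⟩ <;> linarith

theorem PE.shrinkB {R a r b s ε : ℝ} (h : VV R a r b s) (h0 : 0 < ε) (h1 : ε ≤ r) (h2 : ε ≤ s) :
    PE R a r b s R a ε b ε := by
  have s1 := PE.shrinkL h h0 h1
  have h' : VV R a ε b s := by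
    obtain ⟨v1, v2, v3, v4, v5⟩ := h
    refine ⟨h0, v2, ?_, ?_, ?_⟩ <;> linarith
  have s2 := PE.shrinkL h'.mirror h0 h2
  have := (s1.trans (PE.mirror _ _ _ _ _)).trans (s2.trans (PE.mirror _ _ _ _ _))
  simpa using this

theorem PE.pushR {R a r b s b' : ℝ} (hr : 0 < s) (ha : -R ≤ a + r) (h1 : b + 2 * s < R) (h2 : b' + 2 * s < R)
    (h3 : a + r < b - 2 * s) (h4 : a + r < b' - 2 * s) : PE R a r b s R a r b' s := by
  have s1 : PE R (-b) s (-a) r R (-b') s (-a) r := by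
    apply PE.pushL hr <;> linarith
  have := (PE.mirror R a r b s).trans (s1.trans (PE.mirror _ _ _ _ _))
  simpa using this

theorem pants4 {a r b s : ℝ} (h : VV 4 a r b s) : PE 4 a r b s 4 (-2) 1 2 1 := by
  have h' := h
  obtain ⟨v1, v2, v3, v4, v5⟩ := h'
  obtain ⟨ε, e0, e1, e2, e3⟩ : ∃ ε : ℝ, 0 < ε ∧ 4 * ε ≤ r ∧ 4 * ε ≤ s ∧ 4 * ε ≤ 1 := by
    refine ⟨min r (min s 1) / 4, by positivity, ?_, ?_, ?_⟩
    · have := min_le_left r (min s 1); linarith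
    · have := (min_le_right r (min s 1)).trans (min_le_left _ _); linarith
    · have := (min_le_right r (min s 1)).trans (min_le_right _ _); linarith
  have s1 : PE 4 a r b s 4 a ε b ε := PE.shrinkB h e0 (by linarith) (by linarith)
  have hm1 : min a (-2) ≤ a := min_le_left _ _
  have hm2 : min a (-2) ≤ -2 := min_le_right _ _
  have hm3 : -4 < min a (-2) - 2 * ε := by
    have : -4 + 2 * ε < min a (-2) := by rw [lt_min_iff]; constructor <;> linarith
    linarith
  have s2 : PE 4 a ε b ε 4 (min a (-2)) ε b ε := by apply PE.pushL e0 <;> linarith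
  have s3 : PE 4 (min a (-2)) ε b ε 4 (min a (-2)) ε 2 ε := by apply PE.pushR e0 <;> linarith
  have s4 : PE 4 (min a (-2)) ε 2 ε 4 (-2) ε 2 ε := by apply PE.pushL e0 <;> linarith
  have s5 : PE 4 (-2) 1 2 1 4 (-2) ε 2 ε :=
    PE.shrinkB (by unfold VV; norm_num) e0 (by linarith) (by linarith)
  exact s1.trans (s2.trans (s3.trans (s4.trans s5.symm)))

theorem pantsE {R a r b s : ℝ} (h : VV R a r b s) : PE R a r b s 4 (-2) 1 2 1 := by
  obtain ⟨v1, v2, v3, v4, v5⟩ := h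
  have hR : 0 < R := by linarith
  have hk : 0 < 4 / R := by positivity
  have s1 := PE.scale R a r b s (4 / R) hk
  rw [show 4 / R * R = 4 by field_simp] at s1
  refine s1.trans (pants4 ⟨by positivity, by positivity, ?_, ?_, ?_⟩)
  · have := mul_lt_mul_of_pos_left v3 hk
    have e : 4 / R * -R = -4 := by field_simp
    linarith
  · have := mul_lt_mul_of_pos_left v4 hk
    linarith
  · have := mul_lt_mul_of_pos_left v5 hk
    have e : 4 / R * R = 4 := by field_simp
    linarith

theorem inv_id {u : ℂ} (hu : u ≠ 0) {d r q : ℝ} (hq : q = d ^ 2 - r ^ 2) (hq0 : q ≠ 0) :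
    ‖u⁻¹ - ((d / q : ℝ) : ℂ)‖ ^ 2 - (r / q) ^ 2 = (‖u - (d:ℂ)‖ ^ 2 - r ^ 2) / (‖u‖ ^ 2 * q) := by
  have hN : u.re ^ 2 + u.im ^ 2 ≠ 0 := by
    rw [pow_two, pow_two, ← Complex.normSq_apply]; simpa using hu
  simp only [Complex.sq_norm, Complex.normSq_apply, Complex.sub_re, Complex.sub_im, Complex.inv_re,
    Complex.inv_im, Complex.ofReal_re, Complex.ofReal_im]
  field_simp
  rw [hq]
  ring

theorem inv_cmp {u : ℂ} (hu : u ≠ 0) {d r q : ℝ} (hr : 0 < r) (hq : q = d ^ 2 - r ^ 2) (hq0 : 0 < q) :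
    (r ≤ ‖u - (d:ℂ)‖ ↔ r / q ≤ ‖u⁻¹ - ((d / q : ℝ) : ℂ)‖) ∧
    (‖u - (d:ℂ)‖ = r ↔ ‖u⁻¹ - ((d / q : ℝ) : ℂ)‖ = r / q) := by
  have key := inv_id hu hq hq0.ne'
  have hu2 : 0 < ‖u‖ ^ 2 * q := by have := norm_pos_iff.mpr hu; positivity
  rw [eq_div_iff hu2.ne'] at key
  have hrq : 0 < r / q := by positivity
  rw [← sq_le_sq₀ hr.le (norm_nonneg _), ← sq_le_sq₀ hrq.le (norm_nonneg _),
    ← sq_eq_sq₀ (norm_nonneg _) hr.le, ← sq_eq_sq₀ (norm_nonneg _) hrq.le]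
  refine ⟨⟨fun h => ?_, fun h => ?_⟩, ⟨fun h => ?_, fun h => ?_⟩⟩
  · by_contra h'; push Not at h'; nlinarith
  · nlinarith
  · rw [h, sub_self] at key
    have := (mul_eq_zero.mp key).resolve_right hu2.ne'
    linarith
  · rw [h, sub_self, zero_mul] at key; linarith

theorem inv_cmp' {u : ℂ} (hu : u ≠ 0) {d r q : ℝ} (hr : 0 < r) (hq : q = r ^ 2 - d ^ 2) (hq0 : 0 < q) :
    (‖u + (d:ℂ)‖ ≤ r ↔ r / q ≤ ‖u⁻¹ - ((d / q : ℝ) : ℂ)‖) ∧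
    (‖u + (d:ℂ)‖ = r ↔ ‖u⁻¹ - ((d / q : ℝ) : ℂ)‖ = r / q) := by
  have key := inv_id (d := -d) (r := r) (q := -q) hu (by rw [hq]; ring) (by linarith)
  have e1 : u - ((-d : ℝ) : ℂ) = u + d := by push_cast; ring
  have e2 : -d / -q = d / q := by rw [neg_div_neg_eq]
  have e3 : (r / -q) ^ 2 = (r / q) ^ 2 := by rw [div_neg]; ring
  have e4 : ‖u‖ ^ 2 * -q = - (‖u‖ ^ 2 * q) := by ring
  have hu2 : 0 < ‖u‖ ^ 2 * q := by have := norm_pos_iff.mpr hu; positivity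
  rw [e1, e2, e3, e4, eq_div_iff (by linarith)] at key
  have hrq : 0 < r / q := by positivity
  rw [← sq_le_sq₀ (norm_nonneg _) hr.le, ← sq_le_sq₀ hrq.le (norm_nonneg _),
    ← sq_eq_sq₀ (norm_nonneg _) hr.le, ← sq_eq_sq₀ (norm_nonneg _) hrq.le]
  refine ⟨⟨fun h => ?_, fun h => ?_⟩, ⟨fun h => ?_, fun h => ?_⟩⟩
  · by_contra h'; push Not at h'; nlinarith
  · nlinarith
  · rw [h, sub_self] at key
    have := (mul_eq_zero.mp key).resolve_right (by linarith)
    linarith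
  · rw [h, sub_self, zero_mul] at key; linarith

theorem pantsB {R a r b s : ℝ} (h : VV R a r b s) (hb0 : 0 ≤ b) :
    TE (PP R a r b s) {z | ‖z - (b:ℂ)‖ = s} {z | ‖z‖ = R ∨ ‖z - (a:ℂ)‖ = r}
      (PP 4 (-2) 1 2 1) (NS 4) (PV (-2) 1 2 1) := by
  obtain ⟨v1, v2, v3, v4, v5⟩ := h
  have hq1 : 0 < (a - b) ^ 2 - r ^ 2 := by nlinarith
  have hq2 : 0 < R ^ 2 - b ^ 2 := by nlinarith
  have hR : 0 < R := by linarith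
  have e1 : (a - b) ^ 2 - r ^ 2 = (b - a - r) * (b - a + r) := by ring
  have e2 : R ^ 2 - b ^ 2 = (R - b) * (R + b) := by ring
  have p1 : 0 < b - a - r := by linarith
  have p2 : 0 < b - a + r := by linarith
  have p3 : 0 < R - b := by linarith
  have p4 : 0 < R + b := by linarith
  have hV : VV (1 / s) ((a - b) / ((a - b) ^ 2 - r ^ 2)) (r / ((a - b) ^ 2 - r ^ 2))
      (b / (R ^ 2 - b ^ 2)) (R / (R ^ 2 - b ^ 2)) := by
    refine ⟨by positivity, by positivity, ?_, ?_, ?_⟩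
    · rw [← sub_div, e1, show (a - b - r) = - (b - a + r) by ring, neg_div, neg_lt_neg_iff,
        div_mul_cancel_right₀ p2.ne', ← one_div]
      exact one_div_lt_one_div_of_lt v2 (by linarith)
    · rw [← sub_div, ← add_div, e1, e2, show (a - b + r) = - (b - a - r) by ring,
        show b - R = - (R - b) by ring, neg_div, neg_div, neg_lt_neg_iff,
        div_mul_cancel_left₀ p1.ne', div_mul_cancel_left₀ p3.ne', ← one_div, ← one_div]
      exact one_div_lt_one_div_of_lt p2 (by linarith)
    · rw [← add_div, e2, show b + R = R + b by ring, div_mul_cancel_right₀ p4.ne', ← one_div]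
      exact one_div_lt_one_div_of_lt v2 (by linarith)
  refine TE.trans ?_ (pantsE hV)
  have F : ∀ z : ℂ, z - b ≠ 0 →
      (z ∈ PP R a r b s ↔ (z - b)⁻¹ ∈ PP (1 / s) ((a - b) / ((a - b) ^ 2 - r ^ 2)) (r / ((a - b) ^ 2 - r ^ 2))
      (b / (R ^ 2 - b ^ 2)) (R / (R ^ 2 - b ^ 2))) ∧
      (‖z - (b:ℂ)‖ = s ↔ (z - b)⁻¹ ∈ NS (1 / s)) ∧
      ((‖z‖ = R ∨ ‖z - (a:ℂ)‖ = r) ↔ (z - b)⁻¹ ∈ PV ((a - b) / ((a - b) ^ 2 - r ^ 2)) (r / ((a - b) ^ 2 - r ^ 2))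
      (b / (R ^ 2 - b ^ 2)) (R / (R ^ 2 - b ^ 2))) := by
    intro z hz
    have c1 := inv_cmp hz v1 rfl hq1
    have c2 := inv_cmp' hz hR rfl hq2
    have x1 : z - (b:ℂ) - ((a - b : ℝ) : ℂ) = z - a := by push_cast; ring
    have x2 : z - (b:ℂ) + b = z := by ring
    rw [x1] at c1
    rw [x2] at c2
    have hn : 0 < ‖z - (b:ℂ)‖ := norm_pos_iff.mpr hz
    have c3 : s ≤ ‖z - (b:ℂ)‖ ↔ ‖(z - (b:ℂ))⁻¹‖ ≤ 1 / s := by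
      rw [norm_inv, one_div, inv_le_inv₀ hn v2]
    have c4 : ‖z - (b:ℂ)‖ = s ↔ ‖(z - (b:ℂ))⁻¹‖ = 1 / s := by
      rw [norm_inv, one_div, inv_inj]
    simp only [PP, PV, NS, Set.mem_ofPred_eq]
    rw [c1.1, c1.2, c2.1, c2.2, c3, c4]
    exact ⟨⟨fun ⟨x, y, z⟩ => ⟨z, y, x⟩, fun ⟨x, y, z⟩ => ⟨z, y, x⟩⟩, Iff.rfl, or_comm⟩
  have nz : ∀ z ∈ PP R a r b s, z - b ≠ 0 := by
    rintro z ⟨-, -, h⟩ h0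
    rw [h0, norm_zero] at h; linarith
  refine ⟨fun z => (z - b)⁻¹, ?_, ?_, ?_, ?_⟩
  · exact ContinuousOn.inv₀ (by fun_prop) nz
  · intro x _ y _ hxy
    have := inv_injective hxy
    exact sub_left_injective this
  · apply Set.eq_of_subset_of_subset
    · rintro _ ⟨z, hz, rfl⟩
      exact (F z (nz z hz)).1.1 hz
    · intro w hw
      have hw0 : w ≠ 0 := by
        rintro rfl
        have := hw.2.2
        rw [zero_sub, norm_neg, Complex.norm_real, Real.norm_of_nonneg (by positivity)] at this
        rw [div_le_div_iff_of_pos_right hq2] at this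
        linarith
      have hz : (b + w⁻¹ : ℂ) - b = w⁻¹ := by ring
      refine ⟨b + w⁻¹, (F _ ?_).1.2 ?_, ?_⟩
      · rw [hz]; exact inv_ne_zero hw0
      · rw [hz, inv_inv]; exact hw
      · simp
  · intro z hz
    exact (F z (nz z hz)).2

def AA (R a r : ℝ) : Set ℂ := {z | ‖z‖ ≤ R ∧ r ≤ ‖z - (a : ℂ)‖}

theorem AA_compact (R a r : ℝ) : IsCompact (AA R a r) := by
  apply (isCompact_closedBall (0:ℂ) R).of_isClosed_subset
  · have h1 : IsClosed {z : ℂ | ‖z‖ ≤ R} := isClosed_le (by fun_prop) (by fun_prop)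
    have h2 : IsClosed {z : ℂ | r ≤ ‖z - (a:ℂ)‖} := isClosed_le (by fun_prop) (by fun_prop)
    exact h1.inter h2
  · rintro z ⟨h, -⟩; simpa using h

theorem TE.swap {p d v q d' v' : Set ℂ} (h : TE p d v q d' v') : TE p v d q v' d' := by
  obtain ⟨f, fc, fi, fe, fd⟩ := h
  exact ⟨f, fc, fi, fe, fun z hz => (fd z hz).symm⟩

theorem ann_center {R a r : ℝ} (h : |a| + r < R) :
    TE (AA R a r) {z | ‖z - (a:ℂ)‖ = r} (NS R) (AA R 0 r) (NS r) (NS R) := by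
  apply TE.symm (AA_compact _ _ _)
  have hv' : ‖(a : ℂ)‖ < R - r := by rw [Complex.norm_real, Real.norm_eq_abs]; linarith
  have hr : r < R := by linarith [abs_nonneg a]
  refine TE.of_bij (push 0 a r R) (push_cont _ _ _ _) (push_bij _ _ _ _ hv') fun z => ?_
  have h1 := push_hole 0 _ hv' z
  have h2 := push_out 0 (a:ℂ) hr
  simp only [sub_zero, zero_add] at h1 h2
  simp only [AA, NS, Set.mem_ofPred_eq, Complex.ofReal_zero, sub_zero]
  rw [h1.1, h1.2]
  by_cases hz : R ≤ ‖z‖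
  · rw [h2 z hz]; simp
  · have hz' : ¬ R ≤ ‖push 0 a r R z‖ := by
      intro h
      have := (push_bij 0 (a:ℂ) _ _ hv').1 (h2 _ h)
      rw [this] at h; exact hz h
    push Not at hz hz'
    simp [hz.le, hz'.le, hz.ne, hz'.ne]

theorem ann_std {R r α β x y : ℝ} (h0 : 0 < r) (hα : α ≠ 0)
    (hiff : ∀ s, (r ≤ s ∧ s ≤ R) ↔ (1 ≤ α * s + β ∧ α * s + β ≤ 2))
    (hx : ∀ s, (s = r ↔ α * s + β = x)) (hy : ∀ s, (s = R ↔ α * s + β = y)) :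
    TE (AA R 0 r) (NS r) (NS R) {z | 1 ≤ ‖z‖ ∧ ‖z‖ ≤ 2} (NS x) (NS y) := by
  have hA : ∀ z ∈ AA R 0 r, r ≤ ‖z‖ ∧ ‖z‖ ≤ R := by
    rintro z ⟨h1, h2⟩; simp at h2; exact ⟨h2, h1⟩
  have nz : ∀ z ∈ AA R 0 r, z ≠ 0 := by
    intro z hz h; have := (hA z hz).1; rw [h, norm_zero] at this; linarith
  have hn : ∀ z ∈ AA R 0 r, ‖z * ((α * ‖z‖ + β : ℝ) : ℂ) / (‖z‖ : ℂ)‖ = α * ‖z‖ + β := by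
    intro z hz
    have := norm_pos_iff.mpr (nz z hz)
    have h1 := ((hiff _).1 (hA z hz)).1
    rw [norm_div, norm_mul, Complex.norm_real, Complex.norm_real, norm_norm,
      Real.norm_of_nonneg (by linarith)]
    field_simp
  refine ⟨fun z => z * ((α * ‖z‖ + β : ℝ) : ℂ) / (‖z‖ : ℂ), ?_, ?_, ?_, ?_⟩
  · apply ContinuousOn.div (by fun_prop) (by fun_prop)
    intro z hz; simpa using nz z hz
  · intro z hz w hw hzw
    have hzw : z * ((α * ‖z‖ + β : ℝ) : ℂ) / (‖z‖ : ℂ) = w * ((α * ‖w‖ + β : ℝ) : ℂ) / (‖w‖ : ℂ) := hzw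
    have e := hn z hz
    rw [hzw, hn w hw] at e
    have e' : ‖z‖ = ‖w‖ := by
      have : α * ‖z‖ = α * ‖w‖ := by linarith
      exact mul_left_cancel₀ hα this
    rw [e'] at hzw
    have h1 := ((hiff _).1 (hA w hw)).1
    have h2 : ((α * ‖w‖ + β : ℝ) : ℂ) ≠ 0 := by
      have : (α * ‖w‖ + β) ≠ 0 := by linarith
      exact_mod_cast this
    have h3 : (‖w‖ : ℂ) ≠ 0 := by simpa using nz w hw
    rw [div_left_inj' h3] at hzw
    exact mul_right_cancel₀ h2 hzw
  · apply Set.eq_of_subset_of_subset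
    · rintro _ ⟨z, hz, rfl⟩
      simp only [Set.mem_ofPred_eq]
      rw [hn z hz]
      exact (hiff _).1 (hA z hz)
    · intro w hw
      have hw1 : 0 < ‖w‖ := by linarith [hw.1]
      have hs : α * ((‖w‖ - β) / α) + β = ‖w‖ := by field_simp; ring
      have h1 := (hiff ((‖w‖ - β) / α)).2 (by rw [hs]; exact hw)
      generalize (‖w‖ - β) / α = s at *
      have hs0 : 0 < s := by linarith
      have hnn : ‖w * (s:ℂ) / (‖w‖:ℂ)‖ = s := by
        rw [norm_div, norm_mul, Complex.norm_real, Complex.norm_real, norm_norm,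
          Real.norm_of_nonneg hs0.le]
        field_simp
      have hw2 : (‖w‖ : ℂ) ≠ 0 := by exact_mod_cast hw1.ne'
      have hs2 : (s : ℂ) ≠ 0 := by exact_mod_cast hs0.ne'
      refine ⟨w * (s:ℂ) / (‖w‖:ℂ), ⟨?_, ?_⟩, ?_⟩
      · rw [hnn]; exact h1.2
      · rw [Complex.ofReal_zero, sub_zero, hnn]; exact h1.1
      · simp only []
        rw [hnn, hs]; field_simp
  · intro z hz
    simp only [NS, Set.mem_ofPred_eq]
    rw [hn z hz]
    exact ⟨hx _, hy _⟩

theorem annI {R a r : ℝ} (h0 : 0 < r) (h : |a| + r < R) :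
    TE (AA R a r) {z | ‖z - (a:ℂ)‖ = r} (NS R) {z | 1 ≤ ‖z‖ ∧ ‖z‖ ≤ 2} (NS 1) (NS 2) := by
  refine (ann_center h).trans ?_
  have hr : 0 < R - r := by linarith [abs_nonneg a]
  have e : ∀ s, 1 / (R - r) * s + (1 - r / (R - r)) = 1 + (s - r) / (R - r) := by
    intro s; ring
  refine ann_std (α := 1 / (R - r)) (β := 1 - r / (R - r)) h0 (by positivity) ?_ ?_ ?_
  · intro s
    rw [e, le_add_iff_nonneg_right, le_div_iff₀ hr, ← le_sub_iff_add_le', div_le_iff₀ hr]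
    constructor <;> rintro ⟨h1, h2⟩ <;> constructor <;> linarith
  · intro s
    rw [e, add_eq_left, div_eq_zero_iff, or_iff_left hr.ne', sub_eq_zero]
  · intro s
    rw [e, ← eq_sub_iff_add_eq', div_eq_iff hr.ne']
    constructor <;> intro h <;> linarith

theorem annO {R a r : ℝ} (h0 : 0 < r) (h : |a| + r < R) :
    TE (AA R a r) (NS R) {z | ‖z - (a:ℂ)‖ = r} {z | 1 ≤ ‖z‖ ∧ ‖z‖ ≤ 2} (NS 1) (NS 2) := by
  apply TE.swap
  refine (ann_center h).trans ?_
  have hr : 0 < R - r := by linarith [abs_nonneg a]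
  have e : ∀ s, - (1 / (R - r)) * s + (1 + R / (R - r)) = 1 + (R - s) / (R - r) := by
    intro s; ring
  refine ann_std (α := - (1 / (R - r))) (β := 1 + R / (R - r)) h0 (neg_ne_zero.mpr (by positivity)) ?_ ?_ ?_
  · intro s
    rw [e, le_add_iff_nonneg_right, le_div_iff₀ hr, ← le_sub_iff_add_le', div_le_iff₀ hr]
    constructor <;> rintro ⟨h1, h2⟩ <;> constructor <;> linarith
  · intro s
    rw [e, ← eq_sub_iff_add_eq', div_eq_iff hr.ne']
    constructor <;> intro h <;> linarith
  · intro s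
    rw [e, add_eq_left, div_eq_zero_iff, or_iff_left hr.ne', sub_eq_zero, eq_comm]

theorem mem_S {m : ℕ} {z : ℂ} : z ∈ SphereWithHoles m ↔
    ‖z‖ ≤ m ∧ ∀ i : ℕ, 1 ≤ i → i < m → (1/4 : ℝ) ≤ ‖z - (i:ℂ)‖ := by
  unfold SphereWithHoles
  simp only [Set.mem_ofPred_eq]
  refine and_congr_right fun _ => ⟨fun h i h1 h2 => ?_, fun h j hj => ?_⟩
  · have := h (i - 1) (by omega)
    rw [Nat.cast_sub h1] at this
    simpa using this
  · have := h (j + 1) (by omega) (by omega)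
    push_cast at this; exact this

theorem S_compact (m : ℕ) : IsCompact (SphereWithHoles m) := by
  apply (isCompact_closedBall (0:ℂ) m).of_isClosed_subset
  · have h1 : IsClosed {z : ℂ | ‖z‖ ≤ (m:ℝ)} := isClosed_le (by fun_prop) (by fun_prop)
    have h2 : IsClosed {z : ℂ | ∀ j : ℕ, j < m - 1 → (1/4 : ℝ) ≤ ‖z - ((j : ℂ) + 1)‖} := by
      have : {z : ℂ | ∀ j : ℕ, j < m - 1 → (1/4 : ℝ) ≤ ‖z - ((j : ℂ) + 1)‖} =
          ⋂ j : ℕ, ⋂ _ : j < m - 1, {z : ℂ | (1/4 : ℝ) ≤ ‖z - ((j : ℂ) + 1)‖} := by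
        ext z; simp
      rw [this]
      exact isClosed_iInter fun j => isClosed_iInter fun _ =>
        isClosed_le (by fun_prop) (by fun_prop)
    exact h1.inter h2
  · rintro z ⟨h, -⟩; simpa using h

theorem mem_B {m : ℕ} {j : Fin m} {z : ℂ} : z ∈ BCircle m j ↔
    (j.val = 0 ∧ ‖z‖ = m) ∨ (j.val ≠ 0 ∧ ‖z - (j.val : ℂ)‖ = 1/4) := by
  unfold BCircle
  split_ifs with h
  · simp [h]
  · simp [h, dist_eq_norm]

def Pc (m n a i : ℕ) : Set ℂ := {z | z ∈ SphereWithHoles m ∧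
  (0 < i → (a:ℝ) + i + 1/2 ≤ ‖z‖) ∧ (i + 1 < n → ‖z‖ ≤ (a:ℝ) + i + 3/2)}
def Cc (n a : ℕ) : Set ℂ := {z | ∃ l : ℕ, l + 1 < n ∧ ‖z‖ = (a:ℝ) + l + 3/2}
def Dc (m : ℕ) (mark : Fin m → Bool) : Set ℂ := {z | ∃ j, mark j = true ∧ z ∈ BCircle m j}
def Nc (m : ℕ) (mark : Fin m → Bool) : Set ℂ := {z | ∃ j, mark j = false ∧ z ∈ BCircle m j}

structure Adapted (m n a b : ℕ) (o : Bool) (mark : Fin m → Bool) : Prop where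
  hn : 1 ≤ n
  ha : a ≤ 1
  hba : b ≤ a
  h0 : ∀ i : Fin m, i.val = 0 → mark i = o
  h1 : ∀ i : Fin m, i.val ≠ 0 → (mark i = true ↔ a < i.val ∧ i.val + b < m)
  hI : o = false → b = 0 ∧ m = n + a + 1
  hII : o = true → m = n + a + b

section
variable {m n a b : ℕ} {o : Bool} {mark : Fin m → Bool}

theorem Adapted.pos (h : Adapted m n a b o mark) : n + a ≤ m ∧ m ≤ n + a + 1 := by
  have := h.ha; have := h.hba
  cases o
  · have := h.hI rfl; omega
  · have := h.hII rfl; omega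

theorem Adapted.mem_D (h : Adapted m n a b o mark) {z : ℂ} : z ∈ Dc m mark ↔
    (o = true ∧ ‖z‖ = m) ∨ ∃ i : ℕ, a < i ∧ i + b < m ∧ ‖z - (i:ℂ)‖ = 1/4 := by
  have hp := h.pos; have := h.hn
  constructor
  · rintro ⟨j, hj, hz⟩
    rcases mem_B.1 hz with ⟨h1, h2⟩ | ⟨h1, h2⟩
    · left; exact ⟨(h.h0 j h1) ▸ hj, h2⟩
    · right; exact ⟨j, ((h.h1 j h1).1 hj).1, ((h.h1 j h1).1 hj).2, h2⟩
  · rintro (⟨h1, h2⟩ | ⟨i, h1, h2, h3⟩)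
    · exact ⟨⟨0, by omega⟩, by rw [h.h0 _ rfl, h1], mem_B.2 (Or.inl ⟨rfl, h2⟩)⟩
    · refine ⟨⟨i, by omega⟩, (h.h1 _ ?_).2 ⟨h1, h2⟩, mem_B.2 (Or.inr ⟨?_, h3⟩)⟩ <;> simp <;> omega

theorem Adapted.mem_N (h : Adapted m n a b o mark) {z : ℂ} : z ∈ Nc m mark ↔
    (o = false ∧ ‖z‖ = m) ∨
      ∃ i : ℕ, 1 ≤ i ∧ i < m ∧ ¬ (a < i ∧ i + b < m) ∧ ‖z - (i:ℂ)‖ = 1/4 := by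
  have hp := h.pos; have := h.hn
  constructor
  · rintro ⟨j, hj, hz⟩
    rcases mem_B.1 hz with ⟨h1, h2⟩ | ⟨h1, h2⟩
    · left; exact ⟨(h.h0 j h1) ▸ hj, h2⟩
    · right
      refine ⟨j, by omega, j.2, fun hh => ?_, h2⟩
      have := (h.h1 j h1).2 hh
      rw [hj] at this; cases this
  · rintro (⟨h1, h2⟩ | ⟨i, h1, h2, h3, h4⟩)
    · exact ⟨⟨0, by omega⟩, by rw [h.h0 _ rfl, h1], mem_B.2 (Or.inl ⟨rfl, h2⟩)⟩
    · refine ⟨⟨i, h2⟩, ?_, mem_B.2 (Or.inr ⟨by simp; omega, h4⟩)⟩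
      have := (h.h1 ⟨i, h2⟩ (by simp; omega)).not.2 h3
      simpa using this

theorem sep_lo {z : ℂ} {i : ℕ} (h : ‖z‖ + 1/2 ≤ i) : (1/4:ℝ) < ‖z - (i:ℂ)‖ := by
  have := norm_sub_norm_le (i:ℂ) z
  rw [Complex.norm_natCast, norm_sub_rev] at this
  linarith

theorem sep_hi {z : ℂ} {i : ℕ} (h : (i:ℝ) + 1/2 ≤ ‖z‖) : (1/4:ℝ) < ‖z - (i:ℂ)‖ := by
  have := norm_sub_norm_le z (i:ℂ)
  rw [Complex.norm_natCast] at this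
  linarith

theorem Adapted.sep (h : Adapted m n a b o mark) {i : ℕ} (hi : i < n) {z : ℂ}
    (hl : 0 < i → (a:ℝ) + i + 1/2 ≤ ‖z‖) (hu : i + 1 < n → ‖z‖ ≤ (a:ℝ) + i + 3/2)
    {j : ℕ} (hj : 1 ≤ j) (hjm : j < m) :
    j = a + i + 1 ∨ (i = 0 ∧ a = 1 ∧ j = 1) ∨ (1/4:ℝ) < ‖z - (j:ℂ)‖ := by
  have hp := h.pos; have := h.ha
  rcases lt_trichotomy j (a + i + 1) with h1 | h1 | h1
  · right
    rcases Nat.eq_zero_or_pos i with h2 | h2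
    · left; omega
    · right
      apply sep_hi
      have : (j:ℝ) ≤ a + i := by exact_mod_cast (by omega : j ≤ a + i)
      linarith [hl h2]
  · exact Or.inl h1
  · right; right
    apply sep_lo
    have : (a:ℝ) + i + 2 ≤ j := by exact_mod_cast (by omega : a + i + 2 ≤ j)
    linarith [hu (by omega)]

theorem mem_Cc_of {i : ℕ} (hi : i < n) {z : ℂ}
    (hl : 0 < i → (a:ℝ) + i + 1/2 ≤ ‖z‖) (hu : i + 1 < n → ‖z‖ ≤ (a:ℝ) + i + 3/2) :
    z ∈ Cc n a ↔ (0 < i ∧ ‖z‖ = (a:ℝ) + i + 1/2) ∨ (i + 1 < n ∧ ‖z‖ = (a:ℝ) + i + 3/2) := by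
  constructor
  · rintro ⟨l, h1, h2⟩
    rcases lt_trichotomy l i with h3 | h3 | h3
    · left
      have h4 : l + 1 = i := by
        by_contra hne
        have : (l:ℝ) + 2 ≤ i := by exact_mod_cast (by omega : l + 2 ≤ i)
        linarith [hl (by omega)]
      refine ⟨by omega, ?_⟩
      rw [h2, ← h4]; push_cast; ring
    · right; subst h3; exact ⟨h1, h2⟩
    · exfalso
      have : (i:ℝ) + 1 ≤ l := by exact_mod_cast h3
      linarith [hu (by omega)]
  · rintro (⟨h1, h2⟩ | ⟨h1, h2⟩)
    · refine ⟨i - 1, by omega, ?_⟩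
      rw [h2, Nat.cast_sub h1]; push_cast; ring
    · exact ⟨i, h1, h2⟩

def Lo (a i : ℕ) (z : ℂ) : Prop :=
  (0 < i → (a:ℝ) + i + 1/2 ≤ ‖z‖) ∧ (i = 0 → a = 1 → (1/4:ℝ) ≤ ‖z - 1‖)
def LoE (a i : ℕ) (z : ℂ) : Prop :=
  (0 < i ∧ ‖z‖ = (a:ℝ) + i + 1/2) ∨ (i = 0 ∧ a = 1 ∧ ‖z - 1‖ = 1/4)

theorem lo_cases (i : ℕ) (ha : a ≤ 1) : (i = 0 ∧ a = 0 ∧ (∀ z, Lo a i z) ∧ ∀ z, ¬ LoE a i z) ∨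
    ∃ c r : ℝ, 0 ≤ c ∧ 0 < r ∧ c + r < (a + i + 1 : ℕ) - 1/4 ∧ (∀ z, Lo a i z ↔ r ≤ ‖z - (c:ℂ)‖) ∧
      ∀ z, LoE a i z ↔ ‖z - (c:ℂ)‖ = r := by
  rcases Nat.eq_zero_or_pos i with h | h
  · subst h
    have : a = 0 ∨ a = 1 := by omega
    rcases this with rfl | rfl
    · left
      simp [Lo, LoE]
    · right
      refine ⟨1, 1/4, by norm_num, by norm_num, by norm_num, ?_, ?_⟩ <;> intro z <;> simp [Lo, LoE]
  · right
    refine ⟨0, a + i + 1/2, le_rfl, by positivity, by push_cast; linarith, ?_, ?_⟩ <;> intro z <;>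
      simp [Lo, LoE, h, h.ne']

noncomputable def Up (m n a i : ℕ) : ℝ := if i + 1 < n then (a:ℝ) + i + 3/2 else m

theorem Adapted.up_lt (h : Adapted m n a b o mark) {i : ℕ} (hi : i + 1 < n) :
    (a:ℝ) + i + 3/2 < m := by
  have hp := h.pos
  have : (a:ℝ) + i + 2 ≤ m := by exact_mod_cast (by omega : a + i + 2 ≤ m)
  linarith

theorem Adapted.mem_P (h : Adapted m n a b o mark) {i : ℕ} (hi : i < n) {z : ℂ} :
    z ∈ Pc m n a i ↔ ‖z‖ ≤ Up m n a i ∧ Lo a i z ∧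
      (a + i + 1 < m → (1/4:ℝ) ≤ ‖z - ((a + i + 1 : ℕ) : ℂ)‖) := by
  have hp := h.pos; have := h.ha
  unfold Pc Up Lo
  simp only [Set.mem_ofPred_eq, mem_S]
  constructor
  · rintro ⟨⟨h1, h2⟩, h3, h4⟩
    refine ⟨?_, ⟨h3, ?_⟩, fun h5 => h2 _ (by omega) h5⟩
    · split_ifs with hh
      · exact h4 hh
      · exact h1
    · intro h5 h6
      have := h2 1 le_rfl (by omega)
      simpa using this
  · rintro ⟨h1, ⟨h2, h3⟩, h4⟩
    have hu : i + 1 < n → ‖z‖ ≤ (a:ℝ) + i + 3/2 := by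
      intro hh; rwa [if_pos hh] at h1
    refine ⟨⟨?_, ?_⟩, h2, hu⟩
    · split_ifs at h1 with hh
      · exact h1.trans (h.up_lt hh).le
      · exact h1
    · intro j hj hjm
      rcases h.sep hi h2 hu hj hjm with h5 | ⟨h5, h6, h7⟩ | h5
      · subst h5; exact h4 hjm
      · subst h7; simpa using h3 h5 h6
      · exact h5.le

theorem Adapted.P_bounds {i : ℕ} {z : ℂ} (hz : z ∈ Pc m n a i) :
    (0 < i → (a:ℝ) + i + 1/2 ≤ ‖z‖) ∧ (i + 1 < n → ‖z‖ ≤ (a:ℝ) + i + 3/2) := hz.2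

theorem Adapted.P_D (h : Adapted m n a b o mark) {i : ℕ} (hi : i < n) {z : ℂ}
    (hz : z ∈ Pc m n a i) : z ∈ Dc m mark ↔
      (o = true ∧ i + 1 = n ∧ ‖z‖ = m) ∨
      (a + i + 1 + b < m ∧ ‖z - ((a + i + 1 : ℕ) : ℂ)‖ = 1/4) := by
  obtain ⟨hl, hu⟩ := hz.2
  rw [h.mem_D]
  constructor
  · rintro (⟨h1, h2⟩ | ⟨j, h1, h2, h3⟩)
    · left
      refine ⟨h1, ?_, h2⟩
      by_contra hne
      have := h.up_lt (i := i) (by omega)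
      linarith [hu (by omega)]
    · right
      rcases h.sep hi hl hu (j := j) (by omega) (by omega) with h5 | ⟨h5, h6, h7⟩ | h5
      · subst h5; exact ⟨h2, h3⟩
      · omega
      · linarith
  · rintro (⟨h1, h2, h3⟩ | ⟨h1, h2⟩)
    · exact Or.inl ⟨h1, h3⟩
    · exact Or.inr ⟨_, by omega, h1, h2⟩

theorem Adapted.P_N (h : Adapted m n a b o mark) {i : ℕ} (hi : i < n) {z : ℂ}
    (hz : z ∈ Pc m n a i) : z ∈ Nc m mark ∪ Cc n a ↔
      LoE a i z ∨ (i + 1 < n ∧ ‖z‖ = (a:ℝ) + i + 3/2) ∨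
      (o = false ∧ i + 1 = n ∧ ‖z‖ = m) ∨
      (a + i + 1 < m ∧ ¬ (a + i + 1 + b < m) ∧ ‖z - ((a + i + 1 : ℕ) : ℂ)‖ = 1/4) := by
  obtain ⟨hl, hu⟩ := hz.2
  have hp := h.pos
  rw [Set.mem_union, h.mem_N, mem_Cc_of hi hl hu]
  unfold LoE
  constructor
  · rintro ((⟨h1, h2⟩ | ⟨j, h1, h2, h3, h4⟩) | h1 | h1)
    · right; right; left
      refine ⟨h1, ?_, h2⟩
      by_contra hne
      have := h.up_lt (i := i) (by omega)
      linarith [hu (by omega)]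
    · rcases h.sep hi hl hu (j := j) (by omega) (by omega) with h5 | ⟨h5, h6, h7⟩ | h5
      · subst h5
        right; right; right
        exact ⟨h2, by omega, h4⟩
      · subst h7
        left; right; exact ⟨h5, h6, by simpa using h4⟩
      · linarith
    · exact Or.inl (Or.inl h1)
    · exact Or.inr (Or.inl h1)
  · rintro ((h1 | ⟨h1, h2, h3⟩) | h1 | ⟨h1, h2, h3⟩ | ⟨h1, h2, h3⟩)
    · exact Or.inr (Or.inl h1)
    · left; right
      exact ⟨1, le_rfl, by omega, by omega, by simpa using h3⟩
    · exact Or.inr (Or.inr h1)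
    · exact Or.inl (Or.inl ⟨h1, h3⟩)
    · exact Or.inl (Or.inr ⟨_, by omega, h1, by omega, h3⟩)

theorem piece0 {p d v : Set ℂ} (hp : ∀ z, z ∈ p ↔ ‖z‖ ≤ 1)
    (h : ∀ z ∈ p, (z ∈ d ↔ ‖z‖ = 1) ∧ ¬ z ∈ v) :
    ∃ t, TE p d v (PieceSet t) (PieceDir t) (PieceNeu t) := by
  refine ⟨0, TE.congr ?_ ?_⟩
  · ext z; rw [hp]; simp [PieceSet]
  · intro z hz
    have := h z hz
    simp [PieceDir, PieceNeu, this.1, this.2]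

theorem piece1 {p d v : Set ℂ} (h : TE p d v {z | 1 ≤ ‖z‖ ∧ ‖z‖ ≤ 2} (NS 1) (NS 2)) :
    ∃ t, TE p d v (PieceSet t) (PieceDir t) (PieceNeu t) := by
  refine ⟨1, h.trans (TE.congr ?_ ?_)⟩
  · ext z; simp [PieceSet]
  · intro z _
    simp [PieceDir, PieceNeu, NS]

theorem piece2 {p d v : Set ℂ} (h : TE p d v (PP 4 (-2) 1 2 1) (NS 4) (PV (-2) 1 2 1)) :
    ∃ t, TE p d v (PieceSet t) (PieceDir t) (PieceNeu t) := by
  refine ⟨2, h.trans (TE.congr ?_ ?_)⟩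
  · ext z; simp [PieceSet, PP]; tauto
  · intro z _
    simp [PieceDir, PieceNeu, NS, PV, dist_eq_norm]; tauto

theorem Adapted.piece (h : Adapted m n a b o mark) {i : ℕ} (hi : i < n) :
    ∃ t, TE (Pc m n a i) (Dc m mark) (Nc m mark ∪ Cc n a) (PieceSet t) (PieceDir t) (PieceNeu t) := by
  have hp := h.pos; have ha := h.ha; have hba := h.hba
  by_cases hT1 : a + i + 1 + b < m
  · -- the hole is Dirichlet
    have hlast : ¬ i + 1 < n → o = false := by
      intro hh
      by_contra ho
      have := h.hII (by simpa using ho)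
      omega
    have hU : ((a + i + 1 : ℕ) : ℝ) + 1/4 < Up m n a i := by
      unfold Up
      split_ifs with hh
      · push_cast; linarith
      · have : ((a + i + 1 : ℕ) : ℝ) + 1 ≤ m := by exact_mod_cast (by omega : a + i + 1 + 1 ≤ m)
        linarith
    have hD : ∀ z ∈ Pc m n a i, (z ∈ Dc m mark ↔ ‖z - ((a + i + 1 : ℕ) : ℂ)‖ = 1/4) := by
      intro z hz
      rw [h.P_D hi hz]
      constructor
      · rintro (⟨h1, h2, h3⟩ | ⟨h1, h2⟩)
        · rw [hlast (by omega)] at h1; cases h1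
        · exact h2
      · intro h2; exact Or.inr ⟨hT1, h2⟩
    have hN : ∀ z ∈ Pc m n a i, (z ∈ Nc m mark ∪ Cc n a ↔ LoE a i z ∨ ‖z‖ = Up m n a i) := by
      intro z hz
      rw [h.P_N hi hz]
      unfold Up
      by_cases hh : i + 1 < n
      · simp [hh, hh.ne, hT1]
      · have : i + 1 = n := by omega
        have ho := hlast hh
        simp [this, ho, hT1]
    have hJ : a + i + 1 < m := by omega
    rcases lo_cases (a := a) i ha with ⟨-, -, h1, h2⟩ | ⟨c, r, hc, hr, hcr, h1, h2⟩
    · apply piece1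
      refine TE.trans (TE.congr ?_ ?_) (annI (R := Up m n a i) (a := ((a + i + 1 : ℕ) : ℝ)) (r := 1/4)
        (by norm_num) ?_)
      · ext z
        rw [h.mem_P hi]
        simp [AA, h1, hJ]
      · intro z hz
        rw [hD z hz, hN z hz]
        simp [NS, h2]
      · rw [abs_of_nonneg (by positivity)]; exact hU
    · apply piece2
      refine TE.trans (TE.congr ?_ ?_) (pantsB (R := Up m n a i) (a := c) (r := r)
        (b := ((a + i + 1 : ℕ) : ℝ)) (s := 1/4) ⟨hr, by norm_num, ?_, hcr, hU⟩ (by positivity))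
      · ext z
        rw [h.mem_P hi]
        simp [PP, h1, hJ]
      · intro z hz
        rw [hD z hz, hN z hz]
        simp [h2, or_comm]
      · linarith
  · -- last piece, with outer Dirichlet circle
    have hio : i + 1 = n ∧ o = true := by
      cases ho : o
      · have := h.hI ho; omega
      · have := h.hII ho
        exact ⟨by omega, rfl⟩
    obtain ⟨hin, ho⟩ := hio
    have hm := h.hII ho
    have hU : Up m n a i = m := by unfold Up; rw [if_neg (by omega)]
    have hD : ∀ z ∈ Pc m n a i, (z ∈ Dc m mark ↔ ‖z‖ = m) := by
      intro z hz
      rw [h.P_D hi hz]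
      simp [ho, hin, hT1]
    by_cases hJ : a + i + 1 < m
    · have hN : ∀ z ∈ Pc m n a i, (z ∈ Nc m mark ∪ Cc n a ↔
          LoE a i z ∨ ‖z - ((a + i + 1 : ℕ) : ℂ)‖ = 1/4) := by
        intro z hz
        rw [h.P_N hi hz]
        simp only [ho, hin, hJ, hT1]
        simp
      rcases lo_cases (a := a) i ha with ⟨h3, h4, h1, h2⟩ | ⟨c, r, hc, hr, hcr, h1, h2⟩
      · omega
      · have hJ' : ((a + i + 1 : ℕ) : ℝ) + 1 ≤ m := by exact_mod_cast hJ
        apply piece2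
        refine TE.trans (TE.congr ?_ ?_) (pantsE (R := m) (a := c) (r := r)
          (b := ((a + i + 1 : ℕ) : ℝ)) (s := 1/4) ⟨hr, by norm_num, ?_, hcr, ?_⟩)
        · ext z
          rw [h.mem_P hi]
          simp [PP, h1, hJ, hU]
        · intro z hz
          rw [hD z hz, hN z hz]
          simp [h2, NS, PV]
        · linarith
        · linarith
    · have hN : ∀ z ∈ Pc m n a i, (z ∈ Nc m mark ∪ Cc n a ↔ LoE a i z) := by
        intro z hz
        rw [h.P_N hi hz]
        simp only [ho, hin, hJ]
        simp
      rcases lo_cases (a := a) i ha with ⟨h3, h4, h1, h2⟩ | ⟨c, r, hc, hr, hcr, h1, h2⟩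
      · have hm1 : m = 1 := by omega
        apply piece0
        · intro z
          rw [h.mem_P hi]
          simp only [hU, h1, hJ]
          simp [hm1]
        · intro z hz
          rw [hD z hz, hN z hz]
          simp [h2, hm1]
      · have hJ' : ((a + i + 1 : ℕ) : ℝ) = m := by exact_mod_cast (by omega : a + i + 1 = m)
        apply piece1
        refine TE.trans (TE.congr ?_ ?_) (annO (R := m) (a := c) (r := r) hr ?_)
        · ext z
          rw [h.mem_P hi]
          simp [AA, h1, hJ, hU]
        · intro z hz
          rw [hD z hz, hN z hz]
          simp [h2, NS]
        · rw [abs_of_nonneg hc]; linarith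
end

theorem Cc_sep {n a : ℕ} {z : ℂ} (hz : z ∈ Cc n a) :
    ‖z‖ < (n + a : ℕ) ∧ ∀ i : ℕ, (1/4:ℝ) < ‖z - (i:ℂ)‖ := by
  obtain ⟨l, h1, h2⟩ := hz
  constructor
  · have : (l:ℝ) + 2 ≤ n := by exact_mod_cast (by omega : l + 2 ≤ n)
    push_cast; linarith
  · intro i
    rcases le_or_gt i (a + l + 1) with h | h
    · apply sep_hi
      have : (i:ℝ) ≤ a + l + 1 := by exact_mod_cast h
      linarith
    · apply sep_lo
      have : (a:ℝ) + l + 1 + 1 ≤ i := by exact_mod_cast h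
      linarith

theorem Cc_sub {m n a : ℕ} (h : n + a ≤ m) : Cc n a ⊆ SphereWithHoles m := by
  intro z hz
  have h1 := Cc_sep hz
  have h2 : ((n + a : ℕ) : ℝ) ≤ m := by exact_mod_cast h
  exact mem_S.2 ⟨h1.1.le.trans h2, fun i _ _ => (h1.2 i).le⟩

theorem Pc_compact (m n a i : ℕ) : IsCompact (Pc m n a i) := by
  have h1 : IsClosed {z : ℂ | 0 < i → (a:ℝ) + i + 1/2 ≤ ‖z‖} := by
    by_cases h : 0 < i
    · simp only [h, true_imp_iff]; exact isClosed_le (by fun_prop) (by fun_prop)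
    · simp [h]
  have h2 : IsClosed {z : ℂ | i + 1 < n → ‖z‖ ≤ (a:ℝ) + i + 3/2} := by
    by_cases h : i + 1 < n
    · simp only [h, true_imp_iff]; exact isClosed_le (by fun_prop) (by fun_prop)
    · simp [h]
  exact (S_compact m).inter_right (h1.inter h2)

theorem restr {M : Type*} [TopologicalSpace M] {S : Set ℂ} (e : M ≃ₜ S) {p : Set ℂ} (hp : p ⊆ S) :
    ∃ h : {x : M | (e x : ℂ) ∈ p} ≃ₜ p, ∀ x, (h x : ℂ) = e x := by
  refine ⟨{ toFun := fun x => ⟨e x, x.2⟩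
            invFun := fun z => ⟨e.symm ⟨z, hp z.2⟩, by simp⟩
            left_inv := fun x => by simp
            right_inv := fun z => by simp
            continuous_toFun := by fun_prop
            continuous_invFun := by fun_prop }, fun x => rfl⟩

theorem dirSub (t : Fin 3) : PieceDir t ⊆ PieceSet t := by
  intro z hz
  fin_cases t
  · simp [PieceDir, PieceSet] at *; linarith
  · simp [PieceDir, PieceSet] at *; rw [hz]; norm_num
  · simp [PieceDir, PieceSet] at *
    refine ⟨hz.le, ?_, ?_⟩
    · have := norm_sub_norm_le z 2; rw [hz] at this; norm_num at this; linarith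
    · have := norm_sub_norm_le z (-2); rw [hz] at this; norm_num at this; linarith

theorem neuSub (t : Fin 3) : PieceNeu t ⊆ PieceSet t := by
  intro z hz
  fin_cases t
  · simp [PieceNeu] at hz
  · simp [PieceNeu, PieceSet] at *; rw [hz]; norm_num
  · simp only [PieceNeu, PieceSet, Fin.reduceFinMk, Matrix.cons_val, Set.mem_union,
      mem_sphere_iff_norm, Set.mem_ofPred_eq, sub_neg_eq_add] at *
    rcases hz with hz | hz
    · have h1 := norm_add_le (z - 2) 2
      have h2 := norm_sub_le (z + 2) (z - 2)
      rw [show (z + 2) - (z - 2) = 4 by ring] at h2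
      rw [sub_add_cancel] at h1
      norm_num at h1 h2
      refine ⟨?_, ?_, ?_⟩ <;> linarith
    · have h1 := norm_sub_le (z + 2) 2
      have h2 := norm_sub_le (z + 2) (z - 2)
      rw [show (z + 2) - (z - 2) = 4 by ring] at h2
      rw [add_sub_cancel_right] at h1
      norm_num at h1 h2
      refine ⟨?_, ?_, ?_⟩ <;> linarith

def Conc (M : Type*) [TopologicalSpace M] (Dir Neu : Set M) : Prop :=
    ∃ (N : ℕ) (P : Fin N → Set M) (t : Fin N → Fin 3) (C : Set M),
      (∀ i, IsClosed (P i)) ∧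
      (⋃ i, P i) = Set.univ ∧
      (∀ i j, i ≠ j → P i ∩ P j ⊆ C) ∧
      C ∩ (Dir ∪ Neu) = ∅ ∧
      (∃ (m : ℕ) (Q : Fin m → Set M),
        (∀ l, Nonempty (↥(Q l) ≃ₜ ↥(Metric.sphere (0 : ℂ) 1))) ∧
        (∀ l l', l ≠ l' → Disjoint (Q l) (Q l')) ∧
        C = ⋃ l, Q l) ∧
      ∀ i, ∃ h : ↥(P i) ≃ₜ ↥(PieceSet (t i)),
        Subtype.val '' (h '' {x : ↥(P i) | (x : M) ∈ Dir}) = PieceDir (t i) ∧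
        Subtype.val '' (h '' {x : ↥(P i) | (x : M) ∈ Neu ∪ C}) = PieceNeu (t i)

theorem sphere_homeo {ρ : ℝ} (h : 0 < ρ) : Nonempty ({z : ℂ | ‖z‖ = ρ} ≃ₜ sphere (0:ℂ) 1) := by
  have hρ : (ρ:ℂ) ≠ 0 := by exact_mod_cast h.ne'
  obtain ⟨e, -⟩ := exists_homeo (isCompact_sphere (0:ℂ) 1) (q := {z : ℂ | ‖z‖ = ρ})
    (f := fun z => ρ * z) (by fun_prop) (fun x _ y _ hxy => mul_left_cancel₀ hρ hxy) (by
      ext w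
      simp only [Set.mem_image, mem_sphere_iff_norm, sub_zero, Set.mem_ofPred_eq]
      constructor
      · rintro ⟨z, hz, rfl⟩
        rw [norm_mul, Complex.norm_real, Real.norm_of_nonneg h.le, hz, mul_one]
      · intro hw
        refine ⟨w / ρ, ?_, by field_simp⟩
        rw [norm_div, Complex.norm_real, Real.norm_of_nonneg h.le, hw, div_self h.ne'])
  exact ⟨e.symm⟩

theorem core {M : Type*} [TopologicalSpace M] {m n a b : ℕ} {o : Bool} {mark : Fin m → Bool}
    (h : Adapted m n a b o mark) (e : M ≃ₜ SphereWithHoles m) :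
    Conc M {x | (e x : ℂ) ∈ Dc m mark} {x | (e x : ℂ) ∈ Nc m mark} := by
  have hp := h.pos
  have hn := h.hn
  have hec : Continuous fun x => (e x : ℂ) := by fun_prop
  choose t ht using fun i : Fin n => h.piece i.2
  refine ⟨n, fun i => {x | (e x : ℂ) ∈ Pc m n a i}, t, {x | (e x : ℂ) ∈ Cc n a}, ?_, ?_, ?_, ?_, ?_, ?_⟩
  · intro i
    exact (Pc_compact m n a i).isClosed.preimage hec
  · rw [Set.eq_univ_iff_forall]
    intro x
    rw [Set.mem_iUnion]
    by_contra hcon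
    push Not at hcon
    have key : ∀ i : ℕ, i < n → (0 < i → (a:ℝ) + i + 1/2 ≤ ‖(e x : ℂ)‖) := by
      intro i
      induction i with
      | zero => intro _ h0; omega
      | succ i ih =>
        intro hi _
        have h1 := hcon ⟨i, by omega⟩
        by_contra h2
        push Not at h2
        apply h1
        refine ⟨(e x).2, ih (by omega), fun _ => ?_⟩
        push_cast at h2 ⊢
        linarith
    exact hcon ⟨n - 1, by omega⟩ ⟨(e x).2, key (n - 1) (by omega), fun h => by simp at h; omega⟩
  · have key : ∀ i j : Fin n, i < j → ∀ z, z ∈ Pc m n a i → z ∈ Pc m n a j → z ∈ Cc n a := by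
      intro i j hij z h1 h2
      have hij' : i.val < j.val := hij
      have hj := j.2
      refine ⟨i, by omega, ?_⟩
      have h3 := h1.2.2 (by omega)
      have h4 := h2.2.1 (by omega)
      have h5 : (i.val:ℝ) + 1 ≤ j.val := by exact_mod_cast hij'
      linarith
    rintro i j hij x ⟨h1, h2⟩
    rcases lt_or_gt_of_ne hij with hh | hh
    · exact key i j hh _ h1 h2
    · exact key j i hh _ h2 h1
  · rw [Set.eq_empty_iff_forall_notMem]
    rintro x ⟨h1, h2⟩
    have h3 := Cc_sep h1
    have h4 : ((n + a : ℕ) : ℝ) ≤ m := by exact_mod_cast hp.1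
    have : ∃ j, (e x : ℂ) ∈ BCircle m j := by
      rcases h2 with ⟨j, -, hj⟩ | ⟨j, -, hj⟩ <;> exact ⟨j, hj⟩
    obtain ⟨j, hj⟩ := this
    rcases mem_B.1 hj with ⟨-, h5⟩ | ⟨-, h5⟩
    · linarith [h3.1]
    · linarith [h3.2 j]
  · refine ⟨n - 1, fun l => {x | (e x : ℂ) ∈ {z : ℂ | ‖z‖ = (a:ℝ) + l + 3/2}}, ?_, ?_, ?_⟩
    · intro l
      have hl := l.2
      have hsub : {z : ℂ | ‖z‖ = (a:ℝ) + l + 3/2} ⊆ SphereWithHoles m := fun z hz =>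
        Cc_sub hp.1 ⟨l, by omega, hz⟩
      obtain ⟨h1, -⟩ := restr e hsub
      obtain ⟨h2⟩ := sphere_homeo (ρ := (a:ℝ) + l + 3/2) (by positivity)
      exact ⟨h1.trans h2⟩
    · intro l l' hll
      rw [Set.disjoint_left]
      intro x h1 h2
      have h1 : ‖(e x : ℂ)‖ = (a:ℝ) + l + 3/2 := h1
      have h2 : ‖(e x : ℂ)‖ = (a:ℝ) + l' + 3/2 := h2
      apply hll
      have : (l.val : ℝ) = l'.val := by linarith
      exact Fin.ext (by exact_mod_cast this)
    · ext x
      rw [Set.mem_iUnion]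
      constructor
      · rintro ⟨l, h1, h2⟩
        exact ⟨⟨l, by omega⟩, h2⟩
      · rintro ⟨l, h2⟩
        have := l.2
        exact ⟨l, by omega, h2⟩
  · intro i
    obtain ⟨f, fc, fi, fe, fd⟩ := ht i
    obtain ⟨h1, hh1⟩ := restr e (p := Pc m n a i) (fun z hz => hz.1)
    obtain ⟨h2, hh2⟩ := exists_homeo (Pc_compact m n a i) fc fi fe
    have hval : ∀ x, ((h1.trans h2) x : ℂ) = f (e x) := by
      intro x
      rw [Homeomorph.trans_apply, hh2, hh1]
    have gen : ∀ (D : Set M) (d' : Set ℂ), d' ⊆ PieceSet (t i) →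
        (∀ x : M, (e x : ℂ) ∈ Pc m n a i → (x ∈ D ↔ f (e x) ∈ d')) →
        Subtype.val '' ((h1.trans h2) '' {x | (x : M) ∈ D}) = d' := by
      intro D d' hd' hD
      ext w
      constructor
      · rintro ⟨_, ⟨x, hx, rfl⟩, rfl⟩
        rw [hval]
        exact (hD x x.2).1 hx
      · intro hw
        refine ⟨⟨w, hd' hw⟩, ⟨(h1.trans h2).symm ⟨w, hd' hw⟩, ?_, by simp⟩, rfl⟩
        have hx := ((h1.trans h2).symm ⟨w, hd' hw⟩).2
        refine (hD _ hx).2 ?_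
        rw [← hval]; simpa using hw
    refine ⟨h1.trans h2, gen _ _ (dirSub _) ?_, gen _ _ (neuSub _) ?_⟩
    · intro x hx; exact (fd _ hx).1
    · intro x hx; exact (fd _ hx).2

/-- half twist -/
noncomputable def twist (s : ℝ) (c z : ℂ) : ℂ :=
  c + (z - c) * Complex.exp ((s * cut (3/4) 1 ‖z - c‖ : ℝ) * (Real.pi * Complex.I))

theorem twist_norm (s : ℝ) (c z : ℂ) : ‖twist s c z - c‖ = ‖z - c‖ := by
  unfold twist
  rw [add_sub_cancel_left, norm_mul, ← mul_assoc, ← Complex.ofReal_mul,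
    Complex.norm_exp_ofReal_mul_I, mul_one]

theorem twist_cont (s : ℝ) (c : ℂ) : Continuous (twist s c) := by
  unfold twist
  have := cut_cont (3/4) 1
  fun_prop

theorem twist_inv (s : ℝ) (c z : ℂ) : twist (-s) c (twist s c z) = z := by
  have h := twist_norm s c z
  rw [twist, h]
  rw [twist, add_sub_cancel_left, mul_assoc, ← Complex.exp_add, ← add_mul, ← Complex.ofReal_add]
  rw [show s * cut (3/4) 1 ‖z - c‖ + -s * cut (3/4) 1 ‖z - c‖ = 0 by ring]
  simp

theorem twist_bij (c : ℂ) : Function.Bijective (twist 1 c) := by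
  refine Function.bijective_iff_has_inverse.2 ⟨twist (-1) c, twist_inv 1 c, ?_⟩
  intro z
  have := twist_inv (-1) c z
  rwa [neg_neg] at this

theorem twist_in (c z : ℂ) (h : ‖z - c‖ ≤ 3/4) : twist 1 c z = 2 * c - z := by
  rw [twist, cut_in (by norm_num) h]
  simp; ring

theorem twist_out (c z : ℂ) (h : 1 ≤ ‖z - c‖) : twist 1 c z = z := by
  rw [twist, cut_out (by norm_num) h]
  simp

theorem twist_hole (j i : ℕ) (z : ℂ) :
    let f := twist 1 ((j:ℂ) + 1/2)
    let i' := Equiv.swap j (j + 1) i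
    ((1/4:ℝ) ≤ ‖z - (i:ℂ)‖ ↔ (1/4:ℝ) ≤ ‖f z - (i':ℂ)‖) ∧
    (‖z - (i:ℂ)‖ = 1/4 ↔ ‖f z - (i':ℂ)‖ = 1/4) := by
  intro f i'
  set c : ℂ := (j:ℂ) + 1/2 with hc
  have hn := twist_norm 1 c z
  have c1 : ‖(j:ℂ) - c‖ = 1/2 := by rw [hc]; norm_num
  have c2 : ‖((j + 1 : ℕ):ℂ) - c‖ = 1/2 := by
    rw [hc]; push_cast; rw [show (j:ℂ) + 1 - (j + 1/2) = 1/2 by ring]; norm_num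
  have far : ∀ (w : ℂ) (k : ℕ), ‖(k:ℂ) - c‖ = 1/2 → 3/4 < ‖w - c‖ → 1/4 < ‖w - k‖ := by
    intro w k h1 h2
    have := norm_add_le (w - k) (k - c)
    rw [sub_add_sub_cancel] at this; linarith
  by_cases hij : i = j ∨ i = j + 1
  · have hi' : (i:ℂ) + (i':ℂ) = 2 * c := by
      rcases hij with rfl | rfl
      · simp only [i', Equiv.swap_apply_left]; rw [hc]; push_cast; ring
      · simp only [i', Equiv.swap_apply_right]; rw [hc]; push_cast; ring
    have d1 : ‖(i:ℂ) - c‖ = 1/2 := by rcases hij with rfl | rfl <;> assumption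
    have d2 : ‖(i':ℂ) - c‖ = 1/2 := by
      rw [show (i':ℂ) - c = -((i:ℂ) - c) by linear_combination hi', norm_neg, d1]
    rcases le_or_gt ‖z - c‖ (3/4) with h | h
    · have : f z - (i':ℂ) = -(z - i) := by
        simp only [f]; rw [twist_in c z h]; linear_combination -hi'
      rw [this, norm_neg]; simp
    · have e1 := far z i d1 h
      have e2 := far (f z) i' d2 (by simp only [f]; rw [hn]; exact h)
      simp [e1.le, e2.le, e1.ne', e2.ne', -one_div]
  · push Not at hij
    have hi' : i' = i := Equiv.swap_apply_of_ne_of_ne hij.1 hij.2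
    rw [hi']
    have d : (3/2:ℝ) ≤ ‖(i:ℂ) - c‖ := by
      have : (i:ℂ) - c = (((i:ℝ) - j - 1/2 : ℝ) : ℂ) := by rw [hc]; push_cast; ring
      rw [this, Complex.norm_real, Real.norm_eq_abs]
      rcases lt_or_gt_of_ne hij.1 with h | h
      · have : (i:ℝ) + 1 ≤ j := by exact_mod_cast h
        rw [abs_of_nonpos (by linarith)]; linarith
      · have : (j:ℝ) + 2 ≤ i := by exact_mod_cast (by omega : j + 2 ≤ i)
        rw [abs_of_nonneg (by linarith)]; linarith
    rcases le_or_gt 1 ‖z - c‖ with h | h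
    · simp only [f]; rw [twist_out c z h]; simp
    · have far2 : ∀ w : ℂ, ‖w - c‖ < 1 → 1/4 < ‖w - i‖ := by
        intro w hw
        have := norm_sub_le (w - c) (w - i)
        rw [sub_sub_sub_cancel_left] at this
        linarith
      have e1 := far2 z h
      have e2 := far2 (f z) (by simp only [f]; rw [hn]; exact h)
      simp [e1.le, e2.le, e1.ne', e2.ne', -one_div]

theorem twist_outer (j m : ℕ) (hj : j + 2 ≤ m) (z : ℂ) :
    (‖z‖ ≤ m ↔ ‖twist 1 ((j:ℂ) + 1/2) z‖ ≤ m) ∧ (‖z‖ = m ↔ ‖twist 1 ((j:ℂ) + 1/2) z‖ = m) := by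
  set c : ℂ := (j:ℂ) + 1/2 with hc
  have hn := twist_norm 1 c z
  rcases le_or_gt 1 ‖z - c‖ with h | h
  · rw [twist_out c z h]; simp
  · have far2 : ∀ w : ℂ, ‖w - c‖ < 1 → ‖w‖ < m := by
      intro w hw
      have h1 := norm_add_le (w - c) c
      rw [sub_add_cancel] at h1
      have h2 : ‖c‖ = (j:ℝ) + 1/2 := by
        rw [hc, show (j:ℂ) + 1/2 = (((j:ℝ) + 1/2 : ℝ) : ℂ) by push_cast; ring, Complex.norm_real,
          Real.norm_of_nonneg (by positivity)]
      have h3 : (j:ℝ) + 2 ≤ m := by exact_mod_cast hj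
      linarith
    have e1 := far2 z h
    have e2 := far2 _ (hn ▸ h)
    simp [e1.le, e2.le, e1.ne, e2.ne]

/-- permutations of inner circles realized by homeomorphisms -/
def Realiz (q : ℕ) (σ : Equiv.Perm (Fin (q + 1))) : Prop :=
  ∃ τ : SphereWithHoles (q + 2) ≃ₜ SphereWithHoles (q + 2), ∀ x : SphereWithHoles (q + 2),
    ((x : ℂ) ∈ BCircle (q + 2) 0 ↔ (τ x : ℂ) ∈ BCircle (q + 2) 0) ∧
    ∀ i : Fin (q + 1), (x : ℂ) ∈ BCircle (q + 2) i.succ ↔ (τ x : ℂ) ∈ BCircle (q + 2) (σ i).succ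

theorem realiz_swap (q : ℕ) (k : Fin q) : Realiz q (Equiv.swap k.castSucc k.succ) := by
  have hk := k.2
  set j : ℕ := k.val + 1 with hj
  set f := twist 1 ((j:ℂ) + 1/2) with hf
  have hS : ∀ z, z ∈ SphereWithHoles (q + 2) ↔ f z ∈ SphereWithHoles (q + 2) := by
    intro z
    rw [mem_S, mem_S]
    refine and_congr (twist_outer j (q + 2) (by omega) z).1 ?_
    have hrange : ∀ i, 1 ≤ i → i < q + 2 → 1 ≤ Equiv.swap j (j + 1) i ∧ Equiv.swap j (j + 1) i < q + 2 := by
      intro i h1 h2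
      rw [Equiv.swap_apply_def]
      split_ifs <;> omega
    constructor
    · intro h i h1 h2
      have := (twist_hole j (Equiv.swap j (j + 1) i) z).1.1 (h _ (hrange i h1 h2).1 (hrange i h1 h2).2)
      rwa [Equiv.swap_apply_self] at this
    · intro h i h1 h2
      exact (twist_hole j i z).1.2 (h _ (hrange i h1 h2).1 (hrange i h1 h2).2)
  have himg : f '' SphereWithHoles (q + 2) = SphereWithHoles (q + 2) := by
    ext w
    constructor
    · rintro ⟨z, hz, rfl⟩; exact (hS z).1 hz
    · intro hw
      obtain ⟨z, rfl⟩ := (twist_bij ((j:ℂ) + 1/2)).2 w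
      exact ⟨z, (hS z).2 hw, rfl⟩
  obtain ⟨τ, hτ⟩ := exists_homeo (S_compact (q + 2)) (twist_cont 1 _).continuousOn
    (twist_bij ((j:ℂ) + 1/2)).1.injOn himg
  refine ⟨τ, fun x => ⟨?_, fun i => ?_⟩⟩
  · rw [hτ, mem_B, mem_B]
    have := (twist_outer j (q + 2) (by omega) x).2
    simpa using this
  · rw [hτ, mem_B, mem_B]
    have := (twist_hole j (i.val + 1) x).2
    have hsw : Equiv.swap j (j + 1) (i.val + 1) = (Equiv.swap k.castSucc k.succ i).val + 1 := by
      rw [Equiv.swap_apply_def, Equiv.swap_apply_def]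
      simp only [Fin.ext_iff, Fin.val_castSucc, Fin.val_succ]
      split_ifs <;> (try simp only [Fin.val_succ, Fin.val_castSucc]) <;> omega
    rw [hsw] at this
    simpa using this

theorem realiz_all (q : ℕ) (σ : Equiv.Perm (Fin (q + 1))) : Realiz q σ := by
  have hmem : σ ∈ (⊤ : Submonoid (Equiv.Perm (Fin (q + 1)))) := trivial
  rw [← Equiv.Perm.mclosure_swap_castSucc_succ] at hmem
  induction hmem using Submonoid.closure_induction with
  | mem x hx =>
    obtain ⟨k, rfl⟩ := hx
    exact realiz_swap q k
  | one => exact ⟨Homeomorph.refl _, fun x => by simp⟩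
  | mul x y _ _ hx hy =>
    obtain ⟨τ, hτ⟩ := hx
    obtain ⟨τ', hτ'⟩ := hy
    refine ⟨τ'.trans τ, fun z => ⟨?_, fun i => ?_⟩⟩
    · rw [(hτ' z).1, (hτ (τ' z)).1]; rfl
    · rw [(hτ' z).2 i, (hτ (τ' z)).2 (y i)]; rfl

theorem exists_perm {q : ℕ} (f g : Fin (q + 1) → Bool)
    (h : (Finset.univ.filter fun j => f j = true).card = (Finset.univ.filter fun j => g j = true).card) :
    ∃ σ : Equiv.Perm (Fin (q + 1)), ∀ i, f i = g (σ i) := by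
  have h' : Fintype.card {j // f j = true} = Fintype.card {j // g j = true} := by
    rw [Fintype.card_subtype, Fintype.card_subtype, h]
  let E := Fintype.equivOfCardEq h'
  refine ⟨E.extendSubtype, fun i => ?_⟩
  by_cases hi : f i = true
  · rw [hi, E.extendSubtype_mem i hi]
  · have := E.extendSubtype_not_mem i hi
    simp at hi this
    rw [hi, this]

theorem permute {M : Type*} [TopologicalSpace M] {q : ℕ} (e : M ≃ₜ SphereWithHoles (q + 2))
    (mark mark' : Fin (q + 2) → Bool) (h0 : mark 0 = mark' 0)
    (h : (Finset.univ.filter fun j : Fin (q + 1) => mark j.succ = true).card =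
      (Finset.univ.filter fun j : Fin (q + 1) => mark' j.succ = true).card) :
    ∃ e' : M ≃ₜ SphereWithHoles (q + 2), ∀ (x : M),
      ((e x : ℂ) ∈ Dc _ mark ↔ (e' x : ℂ) ∈ Dc _ mark') ∧
      ((e x : ℂ) ∈ Nc _ mark ↔ (e' x : ℂ) ∈ Nc _ mark') := by
  obtain ⟨σ, hσ⟩ := exists_perm (fun j => mark j.succ) (fun j => mark' j.succ) h
  obtain ⟨τ, hτ⟩ := realiz_all q σ
  have key : ∀ (v : Bool) (x : M), (∃ j, mark j = v ∧ (e x : ℂ) ∈ BCircle (q + 2) j) ↔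
      (∃ j, mark' j = v ∧ ((e.trans τ) x : ℂ) ∈ BCircle (q + 2) j) := by
    intro v x
    have hx := hτ (e x)
    refine Fin.exists_fin_succ.trans (Iff.trans ?_ Fin.exists_fin_succ.symm)
    rw [h0, hx.1]
    refine or_congr Iff.rfl ?_
    constructor
    · rintro ⟨i, h1, h2⟩
      exact ⟨σ i, by rw [← h1]; exact (hσ i).symm, (hx.2 i).1 h2⟩
    · rintro ⟨i, h1, h2⟩
      refine ⟨σ.symm i, ?_, ?_⟩
      · rw [← h1]; have := hσ (σ.symm i); simpa using this
      · rw [hx.2]; simpa using h2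
  exact ⟨e.trans τ, fun x => ⟨key true x, key false x⟩⟩

theorem count_std (q a b : ℕ) (_ha : a ≤ 1) (hb : b ≤ 1) :
    (Finset.univ.filter fun j : Fin (q + 1) =>
      a < j.val + 1 ∧ j.val + 1 + b < q + 2).card = q + 1 - a - b := by
  have : (Finset.univ.filter fun j : Fin (q + 1) =>
      a < j.val + 1 ∧ j.val + 1 + b < q + 2).map Fin.valEmbedding = Finset.Ico a (q + 1 - b) := by
    ext x
    simp only [Finset.mem_map, Finset.mem_filter, Finset.mem_univ, true_and, Finset.mem_Ico,
      Fin.valEmbedding_apply]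
    constructor
    · rintro ⟨i, hi, rfl⟩; omega
    · intro h; exact ⟨⟨x, by omega⟩, by simp only; omega, rfl⟩
  rw [← Finset.card_map Fin.valEmbedding, this, Nat.card_Ico]; omega

theorem final_core {M : Type*} [TopologicalSpace M] (n k m : ℕ) (hm : m = n + k)
    (hn : 1 ≤ n) (hk : k ≤ 2) (e : M ≃ₜ SphereWithHoles m) (mark : Fin m → Bool)
    (hmark : (Finset.univ.filter fun j => mark j = true).card = n) :
    Conc M {x | (e x : ℂ) ∈ Dc m mark} {x | (e x : ℂ) ∈ Nc m mark} := by
  rcases m with _ | _ | q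
  · omega
  · have hn1 : n = 1 := by omega
    subst hn1
    have h0 : mark 0 = true := by
      by_contra hc
      rw [Finset.card_eq_one] at hmark
      obtain ⟨j, hj⟩ := hmark
      have : j ∈ Finset.univ.filter fun j => mark j = true := by rw [hj]; simp
      rw [Fin.fin_one_eq_zero j] at this
      simp at this
      exact hc this
    refine core (n := 1) (a := 0) (b := 0) (o := true) ⟨le_rfl, by omega, le_rfl, ?_, ?_, ?_, ?_⟩ e
    · intro i hi; rw [show i = 0 from Fin.ext (by omega)]; exact h0
    · intro i hi; omega
    · simp
    · intro _; rfl
  · have hsplit : (if mark 0 = true then 1 else 0) +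
        (Finset.univ.filter fun j : Fin (q + 1) => mark j.succ = true).card = n := by
      rw [← hmark]
      exact (Fin.card_filter_univ_succ' (fun j => mark j = true)).symm
    have hle : (Finset.univ.filter fun j : Fin (q + 1) => mark j.succ = true).card ≤ q + 1 := by
      have := Finset.card_filter_le (Finset.univ : Finset (Fin (q+1))) (fun j => mark j.succ = true)
      simpa using this
    obtain ⟨a, b, ha, hba, hI, hII, hc⟩ : ∃ a b : ℕ, a ≤ 1 ∧ b ≤ a ∧
        (mark 0 = false → b = 0 ∧ q + 2 = n + a + 1) ∧ (mark 0 = true → q + 2 = n + a + b) ∧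
        (Finset.univ.filter fun j : Fin (q + 1) => mark j.succ = true).card = q + 1 - a - b := by
      cases h0 : mark 0
      · rw [h0] at hsplit
        simp only [Bool.false_eq_true, if_false] at hsplit
        refine ⟨k - 1, 0, by omega, by omega, fun _ => ⟨rfl, by omega⟩, by simp, by omega⟩
      · rw [h0] at hsplit
        simp only [if_true] at hsplit
        refine ⟨min k 1, k - min k 1, by omega, by omega, by simp, fun _ => by omega, by omega⟩
    let mark' : Fin (q + 2) → Bool := fun i =>
      if i.val = 0 then mark 0 else decide (a < i.val ∧ i.val + b < q + 2)
    obtain ⟨e', he'⟩ := permute e mark mark' (by simp [mark']) (by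
      rw [hc, ← count_std q a b ha (by omega)]
      congr 1
      ext j
      simp [mark'])
    have hA : Adapted (q + 2) n a b (mark 0) mark' := by
      refine ⟨hn, ha, hba, ?_, ?_, hI, hII⟩
      · intro i hi; simp only [mark', hi, if_true]
      · intro i hi; simp only [mark', hi, if_false, decide_eq_true_eq]
    have := core hA e'
    rwa [show {x | (e x : ℂ) ∈ Dc (q + 2) mark} = {x | (e' x : ℂ) ∈ Dc (q + 2) mark'} from
      Set.ext fun x => (he' x).1,
      show {x | (e x : ℂ) ∈ Nc (q + 2) mark} = {x | (e' x : ℂ) ∈ Nc (q + 2) mark'} from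
      Set.ext fun x => (he' x).2]

/-- Let `n ≥ 1`, `k ≤ 2`, and let `M` be a surface homeomorphic to a sphere
with `n + k` holes, with `n` boundary circles marked Dirichlet-type (the set
`Dir`) and `k` marked Neumann-type (the set `Neu`). Then `M` can be decomposed,
by cutting along finitely many disjoint simple closed curves `C` in the
interior (each cut circle marked Neumann-type on both sides), into finitely
many pieces, each homeomorphic — respecting the boundary markings — to a disk
with Dirichlet boundary, a cylinder with one Dirichlet and one Neumann
boundary, or a pair of pants with one Dirichlet and two Neumann boundaries. -/
theorem statement6 {M : Type*} [TopologicalSpace M] (n k : ℕ)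
    (hn : 1 ≤ n) (hk : k ≤ 2)
    (e : M ≃ₜ SphereWithHoles (n + k))
    (mark : Fin (n + k) → Bool)
    (hmark : (Finset.univ.filter fun j => mark j = true).card = n)
    (Dir Neu : Set M)
    (hDir : Dir = {x : M | ∃ j, mark j = true ∧ (e x : ℂ) ∈ BCircle (n + k) j})
    (hNeu : Neu = {x : M | ∃ j, mark j = false ∧ (e x : ℂ) ∈ BCircle (n + k) j}) :
    ∃ (N : ℕ) (P : Fin N → Set M) (t : Fin N → Fin 3) (C : Set M),
      (∀ i, IsClosed (P i)) ∧
      (⋃ i, P i) = Set.univ ∧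
      (∀ i j, i ≠ j → P i ∩ P j ⊆ C) ∧
      C ∩ (Dir ∪ Neu) = ∅ ∧
      (∃ (m : ℕ) (Q : Fin m → Set M),
        (∀ l, Nonempty (↥(Q l) ≃ₜ ↥(Metric.sphere (0 : ℂ) 1))) ∧
        (∀ l l', l ≠ l' → Disjoint (Q l) (Q l')) ∧
        C = ⋃ l, Q l) ∧
      ∀ i, ∃ h : ↥(P i) ≃ₜ ↥(PieceSet (t i)),
        Subtype.val '' (h '' {x : ↥(P i) | (x : M) ∈ Dir}) = PieceDir (t i) ∧
        Subtype.val '' (h '' {x : ↥(P i) | (x : M) ∈ Neu ∪ C}) = PieceNeu (t i) := by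
  subst hDir hNeu
  exact final_core n k (n + k) rfl hn hk e mark hmark
end

section
/- Let g : I → ℝ be a smooth function on a bounded open interval I = (a, b) such that for every k ≥ 0 the limits of the k-th derivative g⁽ᵏ⁾ at both endpoints a and b exist. Then g extends to a smooth function on all of ℝ. -/
open Set Filter Topology

/-- If `f` has derivative `g y` at all `y ≠ x` near `x`, with `f`, `g` continuous at `x`,
then `f` has derivative `g x` at `x`. -/
lemma hasDerivAt_of_punctured {f g : ℝ → ℝ} {x : ℝ}
    (h : ∀ᶠ y in 𝓝[≠] x, HasDerivAt f (g y) y) (hf : ContinuousAt f x)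
    (hg : ContinuousAt g x) : HasDerivAt f (g x) x := by
  have hr : ∀ᶠ y in 𝓝[>] x, HasDerivAt f (g y) y :=
    h.filter_mono (nhdsWithin_mono _ fun y hy => ne_of_gt hy)
  have hl : ∀ᶠ y in 𝓝[<] x, HasDerivAt f (g y) y :=
    h.filter_mono (nhdsWithin_mono _ fun y hy => ne_of_lt hy)
  have A : HasDerivWithinAt f (g x) (Ici x) x := by
    refine hasDerivWithinAt_Ici_of_tendsto_deriv (s := {y | HasDerivAt f (g y) y})
      (fun y hy => (HasDerivAt.differentiableAt hy).differentiableWithinAt)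
      hf.continuousWithinAt hr ?_
    exact (hg.tendsto.mono_left nhdsWithin_le_nhds).congr' (hr.mono fun y hy => hy.deriv.symm)
  have B : HasDerivWithinAt f (g x) (Iic x) x := by
    refine hasDerivWithinAt_Iic_of_tendsto_deriv (s := {y | HasDerivAt f (g y) y})
      (fun y hy => (HasDerivAt.differentiableAt hy).differentiableWithinAt)
      hf.continuousWithinAt hl ?_
    exact (hg.tendsto.mono_left nhdsWithin_le_nhds).congr' (hl.mono fun y hy => hy.deriv.symm)
  simpa using B.union A

lemma contDiff_of_tower (D : ℕ → ℝ → ℝ)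
    (h : ∀ k x, HasDerivAt (D k) (D (k + 1) x) x) : ContDiff ℝ (⊤ : ℕ∞) (D 0) := by
  have e : ∀ k, iteratedDeriv k (D 0) = D k := by
    intro k
    induction k with
    | zero => simp
    | succ k ih => rw [iteratedDeriv_succ, ih]; exact funext fun x => (h k x).deriv
  apply contDiff_of_differentiable_iteratedDeriv
  intro m _
  rw [e]
  exact fun x => (h m x).differentiableAt

/-- Borel's lemma at `0`. -/
lemma borel_zero (c : ℕ → ℝ) : ∃ f : ℝ → ℝ, ContDiff ℝ (⊤ : ℕ∞) f ∧
    ∀ k, iteratedDeriv k f 0 = c k := by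
  let ψ : ContDiffBump (0 : ℝ) := ⟨1, 2, by norm_num, by norm_num⟩
  have hψ : ContDiff ℝ (⊤ : ℕ∞) ψ := ψ.contDiff
  let h : ℕ → ℝ → ℝ := fun n x => x ^ n * ψ x
  have hh : ∀ n, ContDiff ℝ (⊤ : ℕ∞) (h n) := fun n => (contDiff_id.pow n).mul hψ
  have hhk : ∀ n (k : ℕ), ContDiff ℝ k (h n) := fun n k => (hh n).of_le (by exact_mod_cast le_top)
  have hbd : ∀ n k : ℕ, ∃ M : ℝ, ∀ x, ‖iteratedDeriv k (h n) x‖ ≤ M := by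
    intro n k
    have hc : HasCompactSupport (h n) := ψ.hasCompactSupport.mul_left
    obtain ⟨M, hM⟩ := ((hhk n k).continuous_iteratedFDeriv le_rfl).bounded_above_of_compact_support
      (hc.iteratedFDeriv (𝕜 := ℝ) k)
    exact ⟨M, fun x => by rw [← norm_iteratedFDeriv_eq_norm_iteratedDeriv]; exact hM x⟩
  choose M hM using hbd
  have hM0 : ∀ n k, 0 ≤ M n k := fun n k => (norm_nonneg _).trans (hM n k 0)
  let d : ℕ → ℝ := fun n => c n / n.factorial
  let S : ℕ → ℝ := fun n => ∑ k ∈ Finset.range n, M n k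
  have hS0 : ∀ n, 0 ≤ S n := fun n => Finset.sum_nonneg fun k _ => hM0 n k
  let l : ℕ → ℝ := fun n => 1 + 2 ^ n * (|d n| * S n)
  have hl1 : ∀ n, 1 ≤ l n := fun n => by
    have := hS0 n
    have : 0 ≤ 2 ^ n * (|d n| * S n) := by positivity
    simp only [l]; linarith
  have hl0 : ∀ n, 0 < l n := fun n => one_pos.trans_le (hl1 n)
  let f : ℕ → ℝ → ℝ := fun n x => (d n * (l n ^ n)⁻¹) * h n (l n * x)
  have hf : ∀ n, ContDiff ℝ (⊤ : ℕ∞) (f n) := fun n =>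
    contDiff_const.mul ((hh n).comp (contDiff_const.mul contDiff_id))
  have hfd : ∀ n k x, iteratedDeriv k (f n) x =
      (d n * (l n ^ n)⁻¹) * (l n ^ k * iteratedDeriv k (h n) (l n * x)) := by
    intro n k x
    simp only [f]
    rw [iteratedDeriv_const_mul_field, iteratedDeriv_comp_const_mul (hhk n k)]
  let v : ℕ → ℕ → ℝ := fun k n =>
    if k < n then (1 / 2) ^ n else |d n * (l n ^ n)⁻¹| * (l n ^ k * M n k)
  have hv : ∀ k : ℕ, (k : ℕ∞) ≤ (⊤ : ℕ∞) → Summable (v k) := by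
    intro k _
    refine (summable_congr_atTop ?_).2 (summable_geometric_two)
    filter_upwards [eventually_gt_atTop k] with n hn
    simp [v, hn]
  have hb : ∀ (k n : ℕ) (x : ℝ), (k : ℕ∞) ≤ (⊤ : ℕ∞) → ‖iteratedFDeriv ℝ k (f n) x‖ ≤ v k n := by
    intro k n x _
    rw [norm_iteratedFDeriv_eq_norm_iteratedDeriv, hfd, norm_mul, norm_mul (l n ^ k), Real.norm_eq_abs (d n * _),
      Real.norm_of_nonneg (pow_nonneg (hl0 n).le k)]
    have h1 : |d n * (l n ^ n)⁻¹| * (l n ^ k * ‖iteratedDeriv k (h n) (l n * x)‖) ≤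
        |d n * (l n ^ n)⁻¹| * (l n ^ k * M n k) := by
      have := hl0 n
      gcongr
      exact hM n k _
    refine h1.trans ?_
    simp only [v]
    split_ifs with hkn
    · have hMS : M n k ≤ S n :=
        Finset.single_le_sum (f := M n) (fun i _ => hM0 n i) (Finset.mem_range.2 hkn)
      have hp : l n ^ (k + 1) ≤ l n ^ n := pow_le_pow_right₀ (hl1 n) hkn
      have hln := hl0 n
      rw [abs_mul, abs_of_pos (inv_pos.2 (pow_pos hln n))]
      have e1 : (l n ^ n)⁻¹ * l n ^ k ≤ (l n)⁻¹ := by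
        rw [inv_mul_le_iff₀ (pow_pos hln n), ← div_eq_mul_inv, le_div_iff₀ hln, ← pow_succ]
        exact hp
      have e2 : |d n| * S n ≤ l n * (1 / 2) ^ n := by
        have : (2 : ℝ) ^ n * (1 / 2) ^ n = 1 := by rw [← mul_pow]; norm_num
        have h2 : l n * (1 / 2) ^ n = (1 / 2) ^ n + |d n| * S n := by
          simp only [l]; linear_combination (|d n| * S n) * this
        rw [h2]
        have : (0 : ℝ) ≤ (1 / 2) ^ n := by positivity
        linarith
      have hM0' := hM0 n k
      calc |d n| * (l n ^ n)⁻¹ * (l n ^ k * M n k)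
          = ((l n ^ n)⁻¹ * l n ^ k) * (|d n| * M n k) := by ring
        _ ≤ (l n)⁻¹ * (|d n| * S n) := by gcongr
        _ ≤ (l n)⁻¹ * (l n * (1 / 2) ^ n) := by gcongr
        _ = (1 / 2) ^ n := by field_simp
    · exact le_rfl
  refine ⟨fun x => ∑' n, f n x, contDiff_tsum hf hv hb, fun k => ?_⟩
  have hsum : Summable fun n => iteratedFDeriv ℝ k (f n) 0 :=
    Summable.of_norm_bounded (hv k le_top) fun n => hb k n 0 le_top
  have hev : ∀ n, iteratedDeriv k (f n) 0 = if n = k then c k else 0 := by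
    intro n
    have : f n =ᶠ[𝓝 0] fun x => d n * x ^ n := by
      have ht : Tendsto (fun x : ℝ => l n * x) (𝓝 0) (𝓝 0) := by
        have : Continuous fun x : ℝ => l n * x := by fun_prop
        simpa using this.tendsto 0
      filter_upwards [ht.eventually ψ.eventuallyEq_one] with x hx
      have hx' : ψ (l n * x) = 1 := hx
      have := (hl0 n).ne'
      simp only [f, h, hx', mul_pow]
      field_simp
    rw [this.iteratedDeriv_eq k, iteratedDeriv_const_mul_field, iteratedDeriv_fun_pow_zero]
    by_cases hnk : n = k
    · subst hnk
      have : (n.factorial : ℝ) ≠ 0 := by positivity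
      simp [d, this]
    · simp [hnk, Ne.symm hnk]
  rw [iteratedDeriv_eq_iteratedFDeriv, iteratedFDeriv_tsum_apply hf hv hb le_top,
    ContinuousMultilinearMap.tsum_eval hsum]
  simp_rw [← iteratedDeriv_eq_iteratedFDeriv, hev]
  exact tsum_ite_eq k _

/-- Borel's lemma. -/
lemma borel_at (p : ℝ) (c : ℕ → ℝ) : ∃ f : ℝ → ℝ, ContDiff ℝ (⊤ : ℕ∞) f ∧
    ∀ k, iteratedDeriv k f p = c k := by
  obtain ⟨f, hf, hc⟩ := borel_zero c
  refine ⟨fun x => f (x - p), hf.comp (contDiff_id.sub contDiff_const), fun k => ?_⟩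
  rw [iteratedDeriv_comp_sub_const]
  simpa using hc k

lemma smooth_tower {f : ℝ → ℝ} (hf : ContDiff ℝ (⊤ : ℕ∞) f) (k : ℕ) (x : ℝ) :
    HasDerivAt (iteratedDeriv k f) (iteratedDeriv (k + 1) f x) x := by
  rw [iteratedDeriv_succ]
  exact (hf.differentiable_iteratedDeriv k (by exact_mod_cast ENat.natCast_lt_top k) x).hasDerivAt

/-- Let `g` be a smooth function on a bounded open interval `(a, b)` such that
for every `k ≥ 0` the limits of the `k`-th derivative at both endpoints exist
(a "strictly-smooth" function). Then `g` extends to a smooth function on `ℝ`. -/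
theorem statement11 (a b : ℝ) (hab : a < b) (g : ℝ → ℝ)
    (hg : ContDiffOn ℝ (⊤ : ℕ∞) g (Ioo a b))
    (ha : ∀ k : ℕ, ∃ L : ℝ,
      Tendsto (iteratedDerivWithin k g (Ioo a b)) (nhdsWithin a (Ioo a b)) (nhds L))
    (hb : ∀ k : ℕ, ∃ L : ℝ,
      Tendsto (iteratedDerivWithin k g (Ioo a b)) (nhdsWithin b (Ioo a b)) (nhds L)) :
    ∃ G : ℝ → ℝ, ContDiff ℝ (⊤ : ℕ∞) G ∧ EqOn G g (Ioo a b) := by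
  choose La hLa using ha
  choose Lb hLb using hb
  rw [nhdsWithin_Ioo_eq_nhdsGT hab] at hLa
  rw [nhdsWithin_Ioo_eq_nhdsLT hab] at hLb
  obtain ⟨A, hA, hAL⟩ := borel_at a La
  obtain ⟨B, hB, hBL⟩ := borel_at b Lb
  let D : ℕ → ℝ → ℝ := fun k x => if x ≤ a then iteratedDeriv k A x else
    if x < b then iteratedDerivWithin k g (Ioo a b) x else iteratedDeriv k B x
  have hDA : ∀ k x, x ≤ a → D k x = iteratedDeriv k A x := fun k x hx => if_pos hx
  have hDg : ∀ k x, x ∈ Ioo a b → D k x = iteratedDerivWithin k g (Ioo a b) x := fun k x hx => by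
    simp only [D, if_neg (not_le.2 hx.1), if_pos hx.2]
  have hDB : ∀ k x, b ≤ x → D k x = iteratedDeriv k B x := fun k x hx => by
    simp only [D, if_neg (not_le.2 (hab.trans_le hx)), if_neg (not_lt.2 hx)]
  -- derivatives away from the endpoints
  have hoff : ∀ k x, x ≠ a → x ≠ b → HasDerivAt (D k) (D (k + 1) x) x := by
    intro k x hxa hxb
    rcases lt_or_gt_of_ne hxa with h | h
    · rw [hDA _ _ h.le]
      refine (smooth_tower hA k x).congr_of_eventuallyEq ?_
      filter_upwards [Iio_mem_nhds h] with y hy using hDA k y (le_of_lt hy)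
    rcases lt_or_gt_of_ne hxb with h' | h'
    · have hx : x ∈ Ioo a b := ⟨h, h'⟩
      have hn : Ioo a b ∈ 𝓝 x := isOpen_Ioo.mem_nhds hx
      rw [hDg _ _ hx, iteratedDerivWithin_succ]
      have hd := hg.differentiableOn_iteratedDerivWithin (m := k)
        (by exact_mod_cast ENat.natCast_lt_top k) isOpen_Ioo.uniqueDiffOn x hx
      refine (hd.hasDerivWithinAt.hasDerivAt hn).congr_of_eventuallyEq ?_
      filter_upwards [hn] with y hy using hDg k y hy
    · rw [hDB _ _ h'.le]
      refine (smooth_tower hB k x).congr_of_eventuallyEq ?_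
      filter_upwards [Ioi_mem_nhds h'] with y hy using hDB k y (le_of_lt hy)
  have hca : ∀ k, ContinuousAt (D k) a := by
    intro k
    rw [continuousAt_iff_continuous_left'_right']
    constructor
    · exact (smooth_tower hA k a).continuousAt.continuousWithinAt.congr
        (fun y hy => hDA k y (le_of_lt hy)) (hDA k a le_rfl)
    · rw [ContinuousWithinAt, hDA k a le_rfl, hAL]
      refine (hLa k).congr' ?_
      filter_upwards [Ioo_mem_nhdsGT hab] with y hy using (hDg k y hy).symm
  have hcb : ∀ k, ContinuousAt (D k) b := by
    intro k
    rw [continuousAt_iff_continuous_left'_right']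
    constructor
    · rw [ContinuousWithinAt, hDB k b le_rfl, hBL]
      refine (hLb k).congr' ?_
      filter_upwards [Ioo_mem_nhdsLT hab] with y hy using (hDg k y hy).symm
    · exact (smooth_tower hB k b).continuousAt.continuousWithinAt.congr
        (fun y hy => hDB k y (le_of_lt hy)) (hDB k b le_rfl)
  have hD : ∀ k x, HasDerivAt (D k) (D (k + 1) x) x := by
    intro k x
    by_cases hxa : x = a
    · subst hxa
      refine hasDerivAt_of_punctured ?_ (hca k) (hca (k + 1))
      filter_upwards [self_mem_nhdsWithin, mem_nhdsWithin_of_mem_nhds (isOpen_ne.mem_nhds hab.ne)]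
        with y h1 h2 using hoff k y h1 h2
    by_cases hxb : x = b
    · subst hxb
      refine hasDerivAt_of_punctured ?_ (hcb k) (hcb (k + 1))
      filter_upwards [self_mem_nhdsWithin, mem_nhdsWithin_of_mem_nhds (isOpen_ne.mem_nhds hab.ne')]
        with y h1 h2 using hoff k y h2 h1
    exact hoff k x hxa hxb
  refine ⟨D 0, contDiff_of_tower D hD, fun x hx => ?_⟩
  rw [hDg 0 x hx, iteratedDerivWithin_zero]
end

section
/- Let I = (a, b) be a bounded open interval and let J₁ = (c₁, d₁), J₂ = (c₂, d₂) be open subintervals with J₁ ∪ J₂ = I and such that {c₁, d₁} ∩ {c₂, d₂} = ∅ (no common endpoints). Let χ₁ : J₁ → (0,∞) and χ₂ : J₂ → (0,∞) be strictly-bump functions, extended by 0 outside their domains, and let χ = χ₁ + χ₂. Then for any strictly-smooth positive functions h₁ : J₁ → ℝ and h₂ : J₂ → ℝ, the function h := (h₁χ₁ + h₂χ₂)/χ, defined on I, is strictly-smooth and positive on I, and h·χ = h₁χ₁ + h₂χ₂ on I. -/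
open Set Filter Topology

/-- A strictly-bump function on `(a,b)`: smooth and positive on `(a,b)`, with
all derivatives tending to `0` at both endpoints (equivalently, its extension
by `0` is smooth on `ℝ`). -/
def StrictlyBumpOn (g : ℝ → ℝ) (a b : ℝ) : Prop :=
  ContDiffOn ℝ (⊤ : ℕ∞) g (Ioo a b) ∧ (∀ x ∈ Ioo a b, 0 < g x) ∧
  (∀ k : ℕ,
    Tendsto (iteratedDerivWithin k g (Ioo a b)) (nhdsWithin a (Ioo a b)) (nhds 0)) ∧
  (∀ k : ℕ,
    Tendsto (iteratedDerivWithin k g (Ioo a b)) (nhdsWithin b (Ioo a b)) (nhds 0))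

/-- A strictly-smooth function on `(a,b)`: smooth, and each derivative has
finite limits at both endpoints (equivalently, it extends smoothly to `ℝ`). -/
def StrictlySmoothOn (g : ℝ → ℝ) (a b : ℝ) : Prop :=
  ContDiffOn ℝ (⊤ : ℕ∞) g (Ioo a b) ∧
  (∀ k : ℕ, ∃ L : ℝ,
    Tendsto (iteratedDerivWithin k g (Ioo a b)) (nhdsWithin a (Ioo a b)) (nhds L)) ∧
  (∀ k : ℕ, ∃ L : ℝ,
    Tendsto (iteratedDerivWithin k g (Ioo a b)) (nhdsWithin b (Ioo a b)) (nhds L))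

theorem aux_ext {f f' : ℝ → ℝ} {c d : ℝ} (hf0 : ∀ x ∉ Ioo c d, f x = 0)
    (hf'0 : ∀ x ∉ Ioo c d, f' x = 0) (hd : ∀ x ∈ Ioo c d, HasDerivAt f (f' x) x)
    (hc : Tendsto f (𝓝[Ioo c d] c) (𝓝 0)) (hc' : Tendsto f' (𝓝[Ioo c d] c) (𝓝 0))
    (hdd : Tendsto f (𝓝[Ioo c d] d) (𝓝 0)) (hdd' : Tendsto f' (𝓝[Ioo c d] d) (𝓝 0))
    (x : ℝ) : HasDerivAt f (f' x) x := by
  have hdiff : DifferentiableOn ℝ f (Ioo c d) :=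
    fun y hy => (hd y hy).differentiableAt.differentiableWithinAt
  have hder : ∀ y ∈ Ioo c d, deriv f y = f' y := fun y hy => (hd y hy).deriv
  by_cases hx : x ∈ Ioo c d
  · exact hd x hx
  rw [hf'0 x hx]
  by_cases hcd : c < d
  swap
  · have : f = fun _ => 0 := by
      funext y; exact hf0 y (fun hy => hcd (hy.1.trans hy.2))
    rw [this]; exact hasDerivAt_const _ _
  have key : ∀ s : Set ℝ, (∀ y ∈ s, y ∉ Ioo c d) → x ∈ s → HasDerivWithinAt f 0 s x := by
    intro s hs hxs
    exact (hasDerivWithinAt_const x s (0:ℝ)).congr (fun y hy => hf0 y (hs y hy)) (hf0 x hx)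
  rcases lt_trichotomy x c with h | h | h
  · exact (key (Iio c) (fun y hy hy' => lt_asymm hy hy'.1) h).hasDerivAt (Iio_mem_nhds h)
  · subst h
    have h1 : HasDerivWithinAt f 0 (Ici x) x := by
      refine hasDerivWithinAt_Ici_of_tendsto_deriv hdiff ?_ (Ioo_mem_nhdsGT hcd) ?_
      · unfold ContinuousWithinAt; rw [hf0 x hx]; exact hc
      · rw [nhdsWithin_Ioo_eq_nhdsGT hcd] at hc'
        refine hc'.congr' ?_
        filter_upwards [Ioo_mem_nhdsGT hcd] with y hy using (hder y hy).symm
    have h2 := (key (Iic x) (fun y hy hy' => absurd hy'.1 (not_lt.2 hy)) self_mem_Iic)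
    have := h2.union h1
    rwa [Iic_union_Ici, hasDerivWithinAt_univ] at this
  · have hdx : d ≤ x := by
      by_contra hh; exact hx ⟨h, not_le.1 hh⟩
    rcases hdx.eq_or_lt with h' | h'
    · subst h'
      have h1 : HasDerivWithinAt f 0 (Iic d) d := by
        refine hasDerivWithinAt_Iic_of_tendsto_deriv hdiff ?_ (Ioo_mem_nhdsLT hcd) ?_
        · unfold ContinuousWithinAt; rw [hf0 d hx]; exact hdd
        · rw [nhdsWithin_Ioo_eq_nhdsLT hcd] at hdd'
          refine hdd'.congr' ?_
          filter_upwards [Ioo_mem_nhdsLT hcd] with y hy using (hder y hy).symm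
      have h2 := (key (Ici d) (fun y hy hy' => absurd hy'.2 (not_lt.2 hy)) self_mem_Ici)
      have := h1.union h2
      rwa [Iic_union_Ici, hasDerivWithinAt_univ] at this
    · exact (key (Ioi d) (fun y hy hy' => lt_asymm hy hy'.2) h').hasDerivAt (Ioi_mem_nhds h')

theorem aux_smooth {g : ℝ → ℝ} {c d : ℝ} (hg : ContDiffOn ℝ (⊤ : ℕ∞) g (Ioo c d))
    (h0 : ∀ x ∉ Ioo c d, g x = 0)
    (hc : ∀ k : ℕ, Tendsto (iteratedDerivWithin k g (Ioo c d)) (𝓝[Ioo c d] c) (𝓝 0))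
    (hd : ∀ k : ℕ, Tendsto (iteratedDerivWithin k g (Ioo c d)) (𝓝[Ioo c d] d) (𝓝 0)) :
    ContDiff ℝ (⊤ : ℕ∞) g := by
  classical
  let D : ℕ → ℝ → ℝ := fun k => (Ioo c d).indicator (iteratedDerivWithin k g (Ioo c d))
  have hDin : ∀ k, ∀ x ∈ Ioo c d, D k x = iteratedDerivWithin k g (Ioo c d) x :=
    fun k x hx => indicator_of_mem hx _
  have hDout : ∀ k, ∀ x ∉ Ioo c d, D k x = 0 := fun k x hx => indicator_of_notMem hx _
  have hT : ∀ k e, Tendsto (iteratedDerivWithin k g (Ioo c d)) (𝓝[Ioo c d] e) (𝓝 0) →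
      Tendsto (D k) (𝓝[Ioo c d] e) (𝓝 0) := by
    intro k e h
    refine h.congr' ?_
    filter_upwards [self_mem_nhdsWithin] with y hy using (hDin k y hy).symm
  have hD : ∀ k x, HasDerivAt (D k) (D (k+1) x) x := by
    intro k x
    refine aux_ext (hDout k) (hDout (k+1)) ?_ (hT _ _ (hc _)) (hT _ _ (hc _))
      (hT _ _ (hd _)) (hT _ _ (hd _)) x
    intro y hy
    rw [hDin _ y hy, iteratedDerivWithin_succ]
    have h1 : DifferentiableWithinAt ℝ (iteratedDerivWithin k g (Ioo c d)) (Ioo c d) y :=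
      hg.differentiableOn_iteratedDerivWithin (by exact_mod_cast WithTop.coe_lt_top k)
        (uniqueDiffOn_Ioo c d) y hy
    have h2 := h1.hasDerivWithinAt.hasDerivAt (isOpen_Ioo.mem_nhds hy)
    refine h2.congr_of_eventuallyEq ?_
    filter_upwards [isOpen_Ioo.mem_nhds hy] with z hz using hDin k z hz
  have hall : ∀ n : ℕ, ∀ k, ContDiff ℝ n (D k) := by
    intro n
    induction n with
    | zero =>
      intro k
      exact contDiff_zero.2 (continuous_iff_continuousAt.2 fun x => (hD k x).continuousAt)
    | succ n ih =>
      intro k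
      have : deriv (D k) = D (k+1) := funext fun x => (hD k x).deriv
      push_cast
      rw [contDiff_succ_iff_deriv]
      refine ⟨fun x => (hD k x).differentiableAt, by simp, ?_⟩
      rw [this]; exact ih _
  have hgD : g = D 0 := by
    funext x
    by_cases hx : x ∈ Ioo c d
    · rw [hDin 0 x hx, iteratedDerivWithin_zero]
    · rw [hDout 0 x hx, h0 x hx]
  rw [hgD]
  exact contDiff_infty.2 fun n => hall n 0

theorem aux_mul_tendsto {h χ : ℝ → ℝ} {c d e : ℝ} (hh : ContDiffOn ℝ (⊤ : ℕ∞) h (Ioo c d))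
    (hχ : ContDiffOn ℝ (⊤ : ℕ∞) χ (Ioo c d))
    (h1 : ∀ k : ℕ, ∃ L : ℝ, Tendsto (iteratedDerivWithin k h (Ioo c d)) (𝓝[Ioo c d] e) (𝓝 L))
    (h2 : ∀ k : ℕ, Tendsto (iteratedDerivWithin k χ (Ioo c d)) (𝓝[Ioo c d] e) (𝓝 0)) (k : ℕ) :
    Tendsto (iteratedDerivWithin k (fun x => h x * χ x) (Ioo c d)) (𝓝[Ioo c d] e) (𝓝 0) := by
  choose L hL using h1
  have key : Tendsto (fun x => ∑ i ∈ Finset.range (k+1), (k.choose i : ℝ) *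
      iteratedDerivWithin i h (Ioo c d) x * iteratedDerivWithin (k - i) χ (Ioo c d) x)
      (𝓝[Ioo c d] e) (𝓝 (∑ i ∈ Finset.range (k+1), (k.choose i : ℝ) * L i * 0)) :=
    tendsto_finsetSum _ fun i _ => ((hL i).const_mul _).mul (h2 _)
  simp only [mul_zero, Finset.sum_const_zero] at key
  refine key.congr' ?_
  filter_upwards [self_mem_nhdsWithin] with x hx
  have := iteratedDerivWithin_mul (n := k) hx (uniqueDiffOn_Ioo c d)
    ((hh x hx).of_le (by exact_mod_cast le_top)) ((hχ x hx).of_le (by exact_mod_cast le_top))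
  exact this.symm

theorem aux_prod {h χ : ℝ → ℝ} {c d : ℝ} (hh : StrictlySmoothOn h c d)
    (hχ : StrictlyBumpOn χ c d) (h0 : ∀ x ∉ Ioo c d, χ x = 0) :
    ContDiff ℝ (⊤ : ℕ∞) (fun x => h x * χ x) :=
  aux_smooth (hh.1.mul hχ.1) (fun x hx => by simp [h0 x hx])
    (aux_mul_tendsto hh.1 hχ.1 hh.2.1 hχ.2.2.1) (aux_mul_tendsto hh.1 hχ.1 hh.2.2 hχ.2.2.2)

theorem aux_left {a b c₁ d₁ c₂ d₂ : ℝ} (hab : a < b) (hcover : Ioo c₁ d₁ ∪ Ioo c₂ d₂ = Ioo a b)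
    (h1 : c₁ < d₁) (h2 : d₂ ≤ c₂ ∨ c₁ < c₂) :
    c₁ = a ∧ ∀ᶠ x in 𝓝[>] a, x ∈ Ioo c₁ d₁ ∧ x ∉ Ioo c₂ d₂ := by
  have hs : Ioo c₁ d₁ ⊆ Ioo a b := hcover ▸ subset_union_left
  obtain ⟨ha, hb⟩ := (Ioo_subset_Ioo_iff h1).1 hs
  have hc : c₁ = a := by
    by_contra hne
    have hlt : a < c₁ := lt_of_le_of_ne ha (Ne.symm hne)
    obtain ⟨y, hy1, hy2⟩ := exists_between hlt
    have hy : y ∈ Ioo c₁ d₁ ∪ Ioo c₂ d₂ := by rw [hcover]; exact ⟨hy1, by linarith⟩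
    rcases hy with hy | hy
    · linarith [hy.1]
    · rcases h2 with h2 | h2 <;> linarith [hy.1, hy.2]
  refine ⟨hc, ?_⟩
  subst hc
  rcases h2 with h2 | h2
  · filter_upwards [Ioo_mem_nhdsGT h1] with x hx
    exact ⟨hx, fun h => by linarith [h.1, h.2]⟩
  · filter_upwards [Ioo_mem_nhdsGT h1, Ioo_mem_nhdsGT h2] with x hx hx'
    exact ⟨hx, fun h => by linarith [h.1, hx'.2]⟩

theorem aux_right {a b c₁ d₁ c₂ d₂ : ℝ} (hab : a < b) (hcover : Ioo c₁ d₁ ∪ Ioo c₂ d₂ = Ioo a b)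
    (h1 : c₁ < d₁) (h2 : d₂ ≤ c₂ ∨ d₂ < d₁) :
    d₁ = b ∧ ∀ᶠ x in 𝓝[<] b, x ∈ Ioo c₁ d₁ ∧ x ∉ Ioo c₂ d₂ := by
  have hs : Ioo c₁ d₁ ⊆ Ioo a b := hcover ▸ subset_union_left
  obtain ⟨ha, hb⟩ := (Ioo_subset_Ioo_iff h1).1 hs
  have hc : d₁ = b := by
    by_contra hne
    have hlt : d₁ < b := lt_of_le_of_ne hb hne
    obtain ⟨y, hy1, hy2⟩ := exists_between hlt
    have hy : y ∈ Ioo c₁ d₁ ∪ Ioo c₂ d₂ := by rw [hcover]; exact ⟨by linarith, hy2⟩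
    rcases hy with hy | hy
    · linarith [hy.2]
    · rcases h2 with h2 | h2 <;> linarith [hy.1, hy.2]
  refine ⟨hc, ?_⟩
  subst hc
  rcases h2 with h2 | h2
  · filter_upwards [Ioo_mem_nhdsLT h1] with x hx
    exact ⟨hx, fun h => by linarith [h.1, h.2]⟩
  · filter_upwards [Ioo_mem_nhdsLT h1, Ioo_mem_nhdsLT h2] with x hx hx'
    exact ⟨hx, fun h => by linarith [h.2, hx'.1]⟩

/-- Transfer of the limit of iterated derivatives for functions agreeing near an endpoint. -/
theorem aux_transfer {f g : ℝ → ℝ} {s t : Set ℝ} (hs : IsOpen s) (ht : IsOpen t) {l : Filter ℝ}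
    {L : ℝ} {k : ℕ} (h : Tendsto (iteratedDerivWithin k g t) l (𝓝 L))
    (hev : ∀ᶠ x in l, x ∈ s ∧ x ∈ t ∧ f =ᶠ[𝓝 x] g) :
    Tendsto (iteratedDerivWithin k f s) l (𝓝 L) := by
  refine h.congr' ?_
  filter_upwards [hev] with x ⟨hxs, hxt, hx⟩
  rw [iteratedDerivWithin_of_isOpen hs hxs, iteratedDerivWithin_of_isOpen ht hxt]
  exact (hx.iteratedDeriv_eq k).symm

theorem aux_limits {a b c₁ d₁ c₂ d₂ : ℝ} {f h : ℝ → ℝ} (hab : a < b)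
    (hcover : Ioo c₁ d₁ ∪ Ioo c₂ d₂ = Ioo a b)
    (hh : StrictlySmoothOn h c₁ d₁) (hfh : ∀ x ∈ Ioo c₁ d₁, x ∉ Ioo c₂ d₂ → f x = h x)
    (h1 : c₁ < d₁) :
    ((d₂ ≤ c₂ ∨ c₁ < c₂) → ∀ k : ℕ, ∃ L : ℝ,
      Tendsto (iteratedDerivWithin k f (Ioo a b)) (𝓝[Ioo a b] a) (𝓝 L)) ∧
    ((d₂ ≤ c₂ ∨ d₂ < d₁) → ∀ k : ℕ, ∃ L : ℝ,
      Tendsto (iteratedDerivWithin k f (Ioo a b)) (𝓝[Ioo a b] b) (𝓝 L)) := by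
  constructor
  · intro h2 k
    obtain ⟨hc, hev⟩ := aux_left hab hcover h1 h2
    subst hc
    obtain ⟨L, hL⟩ := hh.2.1 k
    refine ⟨L, ?_⟩
    rw [nhdsWithin_Ioo_eq_nhdsGT h1] at hL
    rw [nhdsWithin_Ioo_eq_nhdsGT hab]
    refine aux_transfer isOpen_Ioo isOpen_Ioo hL ?_
    filter_upwards [hev, eventually_eventually_nhdsWithin.2 hev, Ioo_mem_nhdsGT hab]
      with x hx hx2 hx3
    refine ⟨hx3, hx.1, ?_⟩
    rw [isOpen_Ioi.nhdsWithin_eq (show x ∈ Ioi c₁ from hx3.1)] at hx2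
    filter_upwards [hx2] with y hy using hfh y hy.1 hy.2
  · intro h2 k
    obtain ⟨hc, hev⟩ := aux_right hab hcover h1 h2
    subst hc
    obtain ⟨L, hL⟩ := hh.2.2 k
    refine ⟨L, ?_⟩
    rw [nhdsWithin_Ioo_eq_nhdsLT h1] at hL
    rw [nhdsWithin_Ioo_eq_nhdsLT hab]
    refine aux_transfer isOpen_Ioo isOpen_Ioo hL ?_
    filter_upwards [hev, eventually_eventually_nhdsWithin.2 hev, Ioo_mem_nhdsLT hab]
      with x hx hx2 hx3
    refine ⟨hx3, hx.1, ?_⟩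
    rw [isOpen_Iio.nhdsWithin_eq (show x ∈ Iio d₁ from hx3.2)] at hx2
    filter_upwards [hx2] with y hy using hfh y hy.1 hy.2

/-- Let `I = (a,b)` and `J₁ = (c₁,d₁)`, `J₂ = (c₂,d₂)` be open subintervals with
`J₁ ∪ J₂ = I` and no common endpoints. Let `χ₁, χ₂` be strictly-bump functions
on `J₁, J₂` extended by `0`, and `χ = χ₁ + χ₂`. Then for any strictly-smooth
positive `h₁, h₂` on `J₁, J₂`, the function `h = (h₁χ₁ + h₂χ₂)/χ` is
strictly-smooth and positive on `I`, and `h·χ = h₁χ₁ + h₂χ₂` on `I`. -/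
theorem statement13 (a b c₁ d₁ c₂ d₂ : ℝ) (hab : a < b)
    (hsub1 : Ioo c₁ d₁ ⊆ Ioo a b) (hsub2 : Ioo c₂ d₂ ⊆ Ioo a b)
    (hcover : Ioo c₁ d₁ ∪ Ioo c₂ d₂ = Ioo a b)
    (hne : ({c₁, d₁} ∩ {c₂, d₂} : Set ℝ) = ∅)
    (χ₁ χ₂ h₁ h₂ : ℝ → ℝ)
    (hχ₁ : StrictlyBumpOn χ₁ c₁ d₁) (hχ₁0 : ∀ x ∉ Ioo c₁ d₁, χ₁ x = 0)
    (hχ₂ : StrictlyBumpOn χ₂ c₂ d₂) (hχ₂0 : ∀ x ∉ Ioo c₂ d₂, χ₂ x = 0)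
    (hh₁ : StrictlySmoothOn h₁ c₁ d₁) (hh₁pos : ∀ x ∈ Ioo c₁ d₁, 0 < h₁ x)
    (hh₂ : StrictlySmoothOn h₂ c₂ d₂) (hh₂pos : ∀ x ∈ Ioo c₂ d₂, 0 < h₂ x) :
    StrictlySmoothOn
      (fun x => (h₁ x * χ₁ x + h₂ x * χ₂ x) / (χ₁ x + χ₂ x)) a b ∧
    (∀ x ∈ Ioo a b,
      0 < (h₁ x * χ₁ x + h₂ x * χ₂ x) / (χ₁ x + χ₂ x)) ∧
    (∀ x ∈ Ioo a b,
      (h₁ x * χ₁ x + h₂ x * χ₂ x) / (χ₁ x + χ₂ x) * (χ₁ x + χ₂ x)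
        = h₁ x * χ₁ x + h₂ x * χ₂ x) := by
  have hχ₁nn : ∀ x, 0 ≤ χ₁ x := fun x => by
    by_cases hx : x ∈ Ioo c₁ d₁
    · exact (hχ₁.2.1 x hx).le
    · exact (hχ₁0 x hx).ge
  have hχ₂nn : ∀ x, 0 ≤ χ₂ x := fun x => by
    by_cases hx : x ∈ Ioo c₂ d₂
    · exact (hχ₂.2.1 x hx).le
    · exact (hχ₂0 x hx).ge
  have hp₁ : ∀ x, 0 ≤ h₁ x * χ₁ x := fun x => by
    by_cases hx : x ∈ Ioo c₁ d₁
    · exact (mul_pos (hh₁pos x hx) (hχ₁.2.1 x hx)).le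
    · simp [hχ₁0 x hx]
  have hp₂ : ∀ x, 0 ≤ h₂ x * χ₂ x := fun x => by
    by_cases hx : x ∈ Ioo c₂ d₂
    · exact (mul_pos (hh₂pos x hx) (hχ₂.2.1 x hx)).le
    · simp [hχ₂0 x hx]
  have hpos : ∀ x ∈ Ioo a b, 0 < χ₁ x + χ₂ x := by
    intro x hx
    rw [← hcover] at hx
    rcases hx with hx | hx
    · exact add_pos_of_pos_of_nonneg (hχ₁.2.1 x hx) (hχ₂nn x)
    · exact add_pos_of_nonneg_of_pos (hχ₁nn x) (hχ₂.2.1 x hx)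
  have hnum : ∀ x ∈ Ioo a b, 0 < h₁ x * χ₁ x + h₂ x * χ₂ x := by
    intro x hx
    rw [← hcover] at hx
    rcases hx with hx | hx
    · exact add_pos_of_pos_of_nonneg (mul_pos (hh₁pos x hx) (hχ₁.2.1 x hx)) (hp₂ x)
    · exact add_pos_of_nonneg_of_pos (hp₁ x) (mul_pos (hh₂pos x hx) (hχ₂.2.1 x hx))
  refine ⟨?_, fun x hx => div_pos (hnum x hx) (hpos x hx),
    fun x hx => div_mul_cancel₀ _ (hpos x hx).ne'⟩
  set f : ℝ → ℝ := fun x => (h₁ x * χ₁ x + h₂ x * χ₂ x) / (χ₁ x + χ₂ x) with hf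
  have hf₁ : ∀ x ∈ Ioo c₁ d₁, x ∉ Ioo c₂ d₂ → f x = h₁ x := by
    intro x hx hx'
    have := (hχ₁.2.1 x hx).ne'
    simp only [hf, hχ₂0 x hx', mul_zero, add_zero]
    field_simp
  have hf₂ : ∀ x ∈ Ioo c₂ d₂, x ∉ Ioo c₁ d₁ → f x = h₂ x := by
    intro x hx hx'
    have := (hχ₂.2.1 x hx).ne'
    simp only [hf, hχ₁0 x hx', mul_zero, zero_add]
    field_simp
  have hcover' : Ioo c₂ d₂ ∪ Ioo c₁ d₁ = Ioo a b := by rw [union_comm, hcover]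
  have hsm : ContDiffOn ℝ (⊤ : ℕ∞) f (Ioo a b) := by
    have k1 := aux_prod hh₁ hχ₁ hχ₁0
    have k2 := aux_prod hh₂ hχ₂ hχ₂0
    have k3 := aux_smooth hχ₁.1 hχ₁0 hχ₁.2.2.1 hχ₁.2.2.2
    have k4 := aux_smooth hχ₂.1 hχ₂0 hχ₂.2.2.1 hχ₂.2.2.2
    exact (k1.add k2).contDiffOn.div (k3.add k4).contDiffOn (fun x hx => (hpos x hx).ne')
  have L₁ := aux_limits (f := f) hab hcover hh₁ hf₁
  have L₂ := aux_limits (f := f) hab hcover' hh₂ hf₂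
  have hcc : c₁ ≠ c₂ := by
    intro h
    have : c₁ ∈ ({c₁, d₁} ∩ {c₂, d₂} : Set ℝ) := by simp [h]
    rw [hne] at this; exact this
  have hdd : d₁ ≠ d₂ := by
    intro h
    have : d₁ ∈ ({c₁, d₁} ∩ {c₂, d₂} : Set ℝ) := by simp [h]
    rw [hne] at this; exact this
  by_cases e1 : c₁ < d₁
  · by_cases e2 : c₂ < d₂
    · refine ⟨hsm, ?_, ?_⟩
      · rcases lt_or_gt_of_ne hcc with h | h
        · exact (L₁ e1).1 (Or.inr h)
        · exact (L₂ e2).1 (Or.inr h)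
      · rcases lt_or_gt_of_ne hdd with h | h
        · exact (L₂ e2).2 (Or.inr h)
        · exact (L₁ e1).2 (Or.inr h)
    · exact ⟨hsm, (L₁ e1).1 (Or.inl (not_lt.1 e2)), (L₁ e1).2 (Or.inl (not_lt.1 e2))⟩
  · have e2 : c₂ < d₂ := by
      by_contra e2
      have : (Ioo a b).Nonempty := nonempty_Ioo.2 hab
      rw [← hcover, Ioo_eq_empty e1, Ioo_eq_empty e2] at this
      simp at this
    exact ⟨hsm, (L₂ e2).1 (Or.inl (not_lt.1 e1)), (L₂ e2).2 (Or.inl (not_lt.1 e1))⟩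
end
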